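/- Fix ε ∈ (0,1]. For each integer m ≥ 0, let â_m := lim_{x→∞} a_m(x) (these limits exist and ∑_{m ≥ 0} â_m converges). Then lim_{x→∞} (1/π_odd(x)) · ∑_{p ≤ x} f_ε(p) = ∑_{m ≥ 0} â_m, where the sum ∑_{p ≤ x} is over odd primes p ≤ x. -/

import Mathlib

open Finset Filter

noncomputable section

/-- `S ℓ p = ∑_{n ≤ ℓ} (n/p)`, the quadratic character sum (Legendre symbol for odd prime `p`). -/
def S (ℓ p : ℕ) : ℤ := ∑ n ∈ Finset.Icc 1 ℓ, jacobiSym (n : ℤ) p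

/-- the first-passage time `f_ε(p) = min {ℓ ≥ 1 : S_ℓ(p) < ε ℓ}`. -/
def fpt (ε : ℝ) (p : ℕ) : ℕ := sInf {ℓ : ℕ | 1 ≤ ℓ ∧ ((S ℓ p : ℝ)) < ε * ℓ}

/-- the odd primes up to a real number `x`. -/
def oddPrimesUpTo (x : ℝ) : Finset ℕ :=
  (Finset.range (⌊x⌋₊ + 1)).filter (fun p => p.Prime ∧ p ≠ 2)

/-- `π_odd(x)`, the number of odd primes up to `x`. -/
def piOdd (x : ℝ) : ℕ := (oddPrimesUpTo x).card

/-- `P_ℓ(x)`, the density of odd primes `p ≤ x` with `S_ℓ(p) ≥ ε ℓ`. -/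
def Pdens (ε : ℝ) (ℓ : ℕ) (x : ℝ) : ℝ :=
  (((oddPrimesUpTo x).filter (fun p => ε * ℓ ≤ (S ℓ p : ℝ))).card : ℝ) / (piOdd x : ℝ)

/-- `a_m(x) = N_m(x)/π_odd(x)`, the proportion of odd primes `p ≤ x` with `f_ε(p) > m`. -/
def aCoef (ε : ℝ) (m : ℕ) (x : ℝ) : ℝ :=
  (((oddPrimesUpTo x).filter (fun p => m < fpt ε p)).card : ℝ) / (piOdd x : ℝ)

/-- `c_u(ℓ)`, the number of triples `(a,b,c) ∈ {1,…,ℓ}³` with `abc = u`. -/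
def cCoef (ℓ u : ℕ) : ℕ :=
  ((Finset.Icc 1 ℓ ×ˢ Finset.Icc 1 ℓ ×ˢ Finset.Icc 1 ℓ).filter
    (fun t => t.1 * t.2.1 * t.2.2 = u)).card

/-- `C_3(ℓ) = ∑_{u,v ≤ ℓ³, uv = □} c_u(ℓ) c_v(ℓ)`. -/
def C3 (ℓ : ℕ) : ℕ :=
  ∑ q ∈ (Finset.Icc 1 (ℓ ^ 3) ×ˢ Finset.Icc 1 (ℓ ^ 3)).filter (fun q => IsSquare (q.1 * q.2)),
    cCoef ℓ q.1 * cCoef ℓ q.2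


/-! Part 1: character sums -/

lemma sum_range_period (g : ℕ → ℤ) (P : ℕ) (hP : 0 < P) (hper : ∀ n, g (n + P) = g n)
    (h0 : ∑ n ∈ range P, g n = 0) (hb : ∀ n, |g n| ≤ 1) (A : ℕ) :
    |∑ n ∈ range A, g n| ≤ P := by
  have key : ∀ k r, ∑ n ∈ range (r + P * k), g n = ∑ n ∈ range r, g n := by
    intro k
    induction k with
    | zero => simp
    | succ k ih =>
      intro r
      have : r + P * (k + 1) = P + (r + P * k) := by ring
      rw [this, Finset.sum_range_add, h0, zero_add, ← ih r]
      apply Finset.sum_congr rfl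
      intro n _
      rw [add_comm, hper]
  rw [← Nat.mod_add_div A P, key]
  calc |∑ n ∈ range (A % P), g n| ≤ ∑ n ∈ range (A % P), |g n| := Finset.abs_sum_le_sum_abs _ _
    _ ≤ ∑ n ∈ range (A % P), 1 := Finset.sum_le_sum fun n _ => hb n
    _ = ((A % P : ℕ) : ℤ) := by simp
    _ ≤ P := by exact_mod_cast (Nat.mod_lt A hP).le

lemma sum_period_zero (g : ℕ → ℤ) (P : ℕ) (hP : 0 < P) (hper : ∀ n, g (n % P) = g n)
    (hmul : ∀ a b, g (a * b) = g a * g b) (c : ℕ) (hc : Nat.Coprime c P) (hgc : g c = -1) :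
    ∑ n ∈ range P, g n = 0 := by
  have hinj : Set.InjOn (fun z => c * z % P) (range P : Set ℕ) := by
    intro a ha b hb hab
    simp only [coe_range, Set.mem_Iio] at ha hb
    have h1 : c * a ≡ c * b [MOD P] := hab
    have h2 : a ≡ b [MOD P] := Nat.ModEq.cancel_left_of_coprime (by rwa [Nat.gcd_comm]) h1
    exact Nat.ModEq.eq_of_lt_of_lt h2 ha hb
  have himg : (range P).image (fun z => c * z % P) = range P := by
    apply Finset.eq_of_subset_of_card_le
    · intro z hz
      obtain ⟨a, _, rfl⟩ := Finset.mem_image.mp hz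
      exact Finset.mem_range.mpr (Nat.mod_lt _ hP)
    · rw [Finset.card_image_of_injOn hinj]
  have h : ∑ n ∈ range P, g n = - ∑ n ∈ range P, g n := by
    conv_lhs => rw [← himg]
    rw [Finset.sum_image hinj, ← Finset.sum_neg_distrib]
    apply Finset.sum_congr rfl
    intro z _
    simp only [hper, hmul, hgc]
    ring
  omega

lemma jac_abs_le (a : ℤ) (b : ℕ) : |jacobiSym a b| ≤ 1 := by
  rcases jacobiSym.trichotomy a b with h | h | h <;> simp [h]

lemma exists_odd_factorization (u : ℕ) (hu : u ≠ 0) (hs : ¬ IsSquare u) :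
    ∃ l e v, Nat.Prime l ∧ Odd e ∧ u = l ^ e * v ∧ ¬ l ∣ v := by
  by_contra hcon
  push Not at hcon
  apply hs
  have hev : ∀ l, Nat.Prime l → Even (u.factorization l) := by
    intro l hl
    by_contra ho
    rw [Nat.not_even_iff_odd] at ho
    exact Nat.not_dvd_ordCompl hl hu
      (hcon l (u.factorization l) (u / l ^ u.factorization l) hl ho
        (Nat.ordProj_mul_ordCompl_eq_self u l).symm)
  refine ⟨∏ p ∈ u.primeFactors, p ^ (u.factorization p / 2), ?_⟩
  rw [← Finset.prod_mul_distrib]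
  conv_lhs => rw [← Nat.prod_factorization_pow_eq_self hu]
  rw [Finsupp.prod, Nat.support_factorization]
  apply Finset.prod_congr rfl
  intro p hp
  rw [← pow_add]
  congr 1
  obtain ⟨r, hr⟩ := hev p (Nat.prime_of_mem_primeFactors hp)
  omega

lemma exists_nonresidue (l : ℕ) (hl : l.Prime) (h2 : l ≠ 2) :
    ∃ c : ℕ, jacobiSym c l = -1 := by
  have := Fact.mk hl
  obtain ⟨a, ha⟩ := quadraticChar_exists_neg_one (F := ZMod l) (by rwa [ZMod.ringChar_zmod_n])
  refine ⟨a.val, ?_⟩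
  rw [← jacobiSym.legendreSym.to_jacobiSym, legendreSym]
  simpa using ha

lemma exists_jac_neg_one (u : ℕ) (hu : u ≠ 0) (hs : ¬ IsSquare u) :
    ∃ c : ℕ, Odd c ∧ jacobiSym u c = -1 := by
  obtain ⟨l, e, v, hl, he, huv, hlv⟩ := exists_odd_factorization u hu hs
  have hv0 : v ≠ 0 := by rintro rfl; simp at hlv
  have fin : ∀ c : ℕ, jacobiSym l c = -1 → jacobiSym v c = 1 → jacobiSym u c = -1 := by
    intro c h1 h2
    rw [huv]; push_cast
    rw [jacobiSym.mul_left, jacobiSym.pow_left, h1, h2, he.neg_one_pow]; norm_num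
  by_cases h2 : l = 2
  · subst h2
    have hvo : Odd v := by
      rw [← Nat.not_even_iff_odd, even_iff_two_dvd]; exact hlv
    have hcop : Nat.Coprime 8 v := by
      have : Nat.Coprime (2 ^ 3) v := Nat.Coprime.pow_left 3 ((Nat.Prime.coprime_iff_not_dvd Nat.prime_two).mpr hlv)
      simpa using this
    obtain ⟨c, hc8, hcv⟩ := Nat.chineseRemainder hcop 5 1
    have hc8' : c % 8 = 5 := hc8
    have hodd : Odd c := by rw [Nat.odd_iff]; omega
    refine ⟨c, hodd, fin c ?_ ?_⟩
    · have := jacobiSym.at_two hodd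
      push_cast
      rw [this, ZMod.χ₈_nat_eq_if_mod_eight]
      simp [hc8']; omega
    · rw [← jacobiSym.quadratic_reciprocity_one_mod_four (by omega) hvo]
      rw [jacobiSym.mod_left' (a₂ := 1), jacobiSym.one_left]
      have : c % v = 1 % v := hcv
      exact_mod_cast this
  · have hlo : Odd l := hl.odd_of_ne_two h2
    obtain ⟨t, ht⟩ := exists_nonresidue l hl h2
    have hcop : Nat.Coprime (4 * v) l := by
      rw [Nat.coprime_comm, hl.coprime_iff_not_dvd, hl.dvd_mul]
      rintro (h | h)
      · have : l ∣ 2 ^ 2 := by simpa using h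
        exact h2 ((Nat.prime_dvd_prime_iff_eq hl Nat.prime_two).mp (hl.dvd_of_dvd_pow this))
      · exact hlv h
    obtain ⟨c, hc4, hcl⟩ := Nat.chineseRemainder hcop 1 t
    have hc4' : c % (4 * v) = 1 := by
      have : c % (4 * v) = 1 % (4 * v) := hc4
      rw [this, Nat.mod_eq_of_lt]; omega
    have hc1 : c % 4 = 1 := by
      have h := Nat.mod_mod_of_dvd c (Dvd.intro v rfl : 4 ∣ 4 * v)
      rw [hc4'] at h; omega
    have hodd : Odd c := by rw [Nat.odd_iff]; omega
    refine ⟨c, hodd, fin c ?_ ?_⟩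
    · rw [← jacobiSym.quadratic_reciprocity_one_mod_four hc1 hlo]
      rw [jacobiSym.mod_left' (a₂ := t), ht]
      have : c % l = t % l := hcl
      exact_mod_cast this
    · rw [jacobiSym.mod_right' v hodd, hc4', jacobiSym.one_right]

/-- partial sums of the character `q ↦ (u/q)` over odd `q`. -/
lemma sum_odd_jac (u : ℕ) (hu : u ≠ 0) (hs : ¬ IsSquare u) (A : ℕ) :
    |∑ q ∈ range A, (if Odd q then jacobiSym u q else 0)| ≤ 4 * u := by
  obtain ⟨c, hco, hc⟩ := exists_jac_neg_one u hu hs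
  set g : ℕ → ℤ := fun q => if Odd q then jacobiSym u q else 0 with hg
  have hodd : ∀ n, Odd (n % (4 * u)) ↔ Odd n := by
    intro n
    rw [Nat.odd_iff, Nat.odd_iff, Nat.mod_mod_of_dvd n ⟨2 * u, by ring⟩]
  have hper : ∀ n, g (n % (4 * u)) = g n := by
    intro n
    simp only [hg, hodd]
    split_ifs with h
    · rw [← jacobiSym.mod_right' u h]
    · rfl
  have hmul : ∀ a b, g (a * b) = g a * g b := by
    intro a b
    simp only [hg, Nat.odd_mul]
    by_cases ha : Odd a <;> by_cases hb : Odd b <;> simp [ha, hb]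
    exact jacobiSym.mul_right' _ ha.pos.ne' hb.pos.ne'
  have hcc : Nat.Coprime c (4 * u) := by
    have h1 : Nat.Coprime c (2 ^ 2) := Nat.Coprime.pow_right 2 (Nat.coprime_two_right.mpr hco)
    have h2 : Nat.Coprime c u := by
      by_contra hne
      have : jacobiSym u c = 0 := by
        rw [jacobiSym.eq_zero_iff]
        refine ⟨hco.pos.ne', ?_⟩
        rw [Int.gcd_natCast_natCast, Nat.gcd_comm]; exact hne
      omega
    exact Nat.Coprime.mul_right (by simpa using h1) h2
  have h0 := sum_period_zero g (4 * u) (by omega) hper hmul c hcc (by simp [hg, hco, hc])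
  have := sum_range_period g (4 * u) (by omega)
    (fun n => by rw [← hper (n + 4 * u), Nat.add_mod_right, hper]) h0
    (fun n => by
      simp only [hg]; split_ifs
      · exact jac_abs_le _ _
      · simp) A
  exact_mod_cast this

lemma sum_two_primes (p q : ℕ) (hp : p.Prime) (hq : q.Prime) (hp2 : p ≠ 2) (hpq : p ≠ q)
    (A : ℕ) :
    |∑ n ∈ range A, jacobiSym n p * jacobiSym n q| ≤ (p * q : ℕ) := by
  obtain ⟨t, ht⟩ := exists_nonresidue p hp hp2
  obtain ⟨c, hcp, hcq⟩ := Nat.chineseRemainder ((Nat.coprime_primes hp hq).mpr hpq) t 1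
  have e1 : jacobiSym c p = -1 := by
    rw [jacobiSym.mod_left' (a₂ := t), ht]
    have : c % p = t % p := hcp
    exact_mod_cast this
  have e2 : jacobiSym c q = 1 := by
    rw [jacobiSym.mod_left' (a₂ := 1), jacobiSym.one_left]
    have : c % q = 1 % q := hcq
    exact_mod_cast this
  have cop : ∀ r : ℕ, r.Prime → jacobiSym c r ≠ 0 → Nat.Coprime c r := by
    intro r hr h
    by_contra hne
    apply h
    rw [jacobiSym.eq_zero_iff]
    exact ⟨hr.ne_zero, by rw [Int.gcd_natCast_natCast]; exact hne⟩
  set g : ℕ → ℤ := fun n => jacobiSym n p * jacobiSym n q with hg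
  have hper : ∀ n, g (n % (p * q)) = g n := by
    intro n
    simp only [hg]
    congr 1
    · apply jacobiSym.mod_left'
      exact_mod_cast Nat.mod_mod_of_dvd n (Dvd.intro q rfl)
    · apply jacobiSym.mod_left'
      exact_mod_cast Nat.mod_mod_of_dvd n (Dvd.intro_left p rfl)
  have hmul : ∀ a b, g (a * b) = g a * g b := by
    intro a b
    simp only [hg]; push_cast
    rw [jacobiSym.mul_left, jacobiSym.mul_left]; ring
  have hpos : 0 < p * q := Nat.mul_pos hp.pos hq.pos
  have h0 := sum_period_zero g (p * q) hpos hper hmul c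
    (Nat.Coprime.mul_right (cop p hp (by omega)) (cop q hq (by omega))) (by simp [hg, e1, e2])
  exact sum_range_period g (p * q) hpos
    (fun n => by rw [← hper (n + p * q), Nat.add_mod_right, hper]) h0
    (fun n => by
      simp only [hg, abs_mul]
      exact mul_le_one₀ (jac_abs_le _ _) (abs_nonneg _) (jac_abs_le _ _)) A


/-! Part 2: Selberg weights -/

lemma sum_mu_div (g : ℕ) (hg : g ≠ 0) :
    ∑ d ∈ g.divisors, (ArithmeticFunction.moebius (g / d) : ℤ) = if g = 1 then 1 else 0 := by
  have h := congrArg (fun f => f g) ArithmeticFunction.coe_zeta_mul_moebius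
  simp only [ArithmeticFunction.coe_zeta_mul_apply, ArithmeticFunction.one_apply] at h
  rw [Nat.sum_div_divisors g (fun d => (ArithmeticFunction.moebius d : ℤ)), h]

lemma sum_mu_between (R e f : ℕ) (he : e ∈ Icc 1 R) (hf : f ∈ Icc 1 R) :
    ∑ d ∈ Icc 1 R, (if e ∣ d ∧ d ∣ f then (ArithmeticFunction.moebius (f / d) : ℤ) else 0)
      = if e = f then 1 else 0 := by
  rw [Finset.mem_Icc] at he hf
  by_cases hef : e ∣ f
  · obtain ⟨g, rfl⟩ := hef
    have hg : g ≠ 0 := by rintro rfl; simp at hf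
    rw [← Finset.sum_filter]
    have : ∑ d ∈ Icc 1 R with e ∣ d ∧ d ∣ e * g, (ArithmeticFunction.moebius (e * g / d) : ℤ)
        = ∑ d ∈ g.divisors, (ArithmeticFunction.moebius (g / d) : ℤ) := by
      symm
      apply Finset.sum_bij (fun d _ => e * d)
      · intro d hd
        have hd' := Nat.dvd_of_mem_divisors hd
        have hdp : 0 < d := Nat.pos_of_mem_divisors hd
        simp only [Finset.mem_filter, Finset.mem_Icc]
        refine ⟨⟨Nat.mul_pos he.1 hdp, ?_⟩, Dvd.intro d rfl, Nat.mul_dvd_mul_left e hd'⟩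
        exact (Nat.mul_le_mul_left e (Nat.le_of_dvd (Nat.pos_of_ne_zero hg) hd')).trans hf.2
      · intro a _ b _ hab
        exact Nat.eq_of_mul_eq_mul_left he.1 hab
      · intro d hd
        simp only [Finset.mem_filter, Finset.mem_Icc] at hd
        obtain ⟨_, ⟨d', rfl⟩, h2⟩ := hd
        exact ⟨d', Nat.mem_divisors.mpr ⟨Nat.dvd_of_mul_dvd_mul_left he.1 h2, hg⟩, rfl⟩
      · intro d _
        rw [Nat.mul_div_mul_left _ _ he.1]
    rw [this, sum_mu_div g hg]
    have : g = 1 ↔ e = e * g := by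
      constructor
      · rintro rfl; simp
      · intro h
        exact (Nat.eq_of_mul_eq_mul_left he.1 (by rw [mul_one]; exact h)).symm
    simp only [this]
  · rw [if_neg (by rintro rfl; exact hef dvd_rfl)]
    apply Finset.sum_eq_zero
    intro d _
    rw [if_neg]
    rintro ⟨h1, h2⟩
    exact hef (h1.trans h2)

lemma sum_inv_sq_le (R : ℕ) : ∑ b ∈ Icc 1 R, ((b : ℝ) ^ 2)⁻¹ ≤ 2 := by
  have : ∀ R : ℕ, ∑ b ∈ Icc 1 (R + 1), ((b : ℝ) ^ 2)⁻¹ ≤ 2 - 1 / (R + 1 : ℝ) := by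
    intro R
    induction R with
    | zero => norm_num
    | succ R ih =>
      rw [Finset.sum_Icc_succ_top (by omega)]
      have h : ((((R + 1 + 1 : ℕ) : ℝ)) ^ 2)⁻¹ ≤ 1 / (R + 1 : ℝ) - 1 / (R + 1 + 1 : ℝ) := by
        push_cast
        rw [div_sub_div _ _ (by positivity) (by positivity), inv_eq_one_div,
          div_le_div_iff₀ (by positivity) (by positivity)]
        nlinarith [(Nat.cast_nonneg R : (0 : ℝ) ≤ R)]
      push_cast at h ⊢
      push_cast at ih
      linarith
  rcases R with _ | R
  · simp
  · have := this R
    have h : (0 : ℝ) ≤ 1 / (R + 1 : ℝ) := by positivity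
    linarith

lemma harmonic_real (R : ℕ) : (harmonic R : ℝ) = ∑ n ∈ Icc 1 R, (n : ℝ)⁻¹ := by
  simp only [harmonic_eq_sum_Icc, Rat.cast_sum, Rat.cast_inv, Rat.cast_natCast]

def selL (R : ℕ) : ℝ :=
  ∑ e ∈ Icc 1 R, ((ArithmeticFunction.moebius e : ℤ) : ℝ) ^ 2 / (Nat.totient e : ℝ)

lemma selL_ge (R : ℕ) : Real.log (R + 1) / 2 ≤ selL R := by
  have h1 : Real.log (R + 1) ≤ ∑ n ∈ Icc 1 R, (n : ℝ)⁻¹ := by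
    have := log_add_one_le_harmonic R
    rw [harmonic_real] at this
    exact_mod_cast this
  have h2 : ∑ e ∈ (Icc 1 R).filter Squarefree, (e : ℝ)⁻¹ ≤ selL R := by
    rw [selL, Finset.sum_filter]
    apply Finset.sum_le_sum
    intro e he
    rw [Finset.mem_Icc] at he
    split_ifs with hs
    · have : ((ArithmeticFunction.moebius e : ℤ) : ℝ) ^ 2 = 1 := by
        exact_mod_cast ArithmeticFunction.moebius_sq_eq_one_of_squarefree hs
      rw [this, inv_eq_one_div]
      apply one_div_le_one_div_of_le
      · exact_mod_cast Nat.totient_pos.mpr he.1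
      · exact_mod_cast Nat.totient_le e
    · positivity
  have h3 : ∑ n ∈ Icc 1 R, (n : ℝ)⁻¹
      ≤ (∑ b ∈ Icc 1 R, ((b : ℝ) ^ 2)⁻¹) * ∑ e ∈ (Icc 1 R).filter Squarefree, (e : ℝ)⁻¹ := by
    have hex : ∀ n : ℕ, ∃ q : ℕ × ℕ, 0 < n → 0 < q.2 ∧ 0 < q.1 ∧ q.1 ^ 2 * q.2 = n ∧ Squarefree q.2 := by
      intro n
      rcases Nat.eq_zero_or_pos n with h | h
      · exact ⟨(0, 0), by omega⟩
      · obtain ⟨a, b, h⟩ := Nat.sq_mul_squarefree_of_pos h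
        exact ⟨(b, a), fun _ => h⟩
    choose F hF using hex
    rw [Finset.sum_mul_sum, ← Finset.sum_product']
    have hinj : Set.InjOn F (Icc 1 R : Set ℕ) := by
      intro a ha b hb hab
      simp only [Finset.coe_Icc, Set.mem_Icc] at ha hb
      rw [← (hF a ha.1).2.2.1, ← (hF b hb.1).2.2.1, hab]
    calc ∑ n ∈ Icc 1 R, (n : ℝ)⁻¹
        = ∑ q ∈ (Icc 1 R).image F, ((q.1 : ℝ) ^ 2)⁻¹ * (q.2 : ℝ)⁻¹ := by
          rw [Finset.sum_image hinj]
          apply Finset.sum_congr rfl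
          intro n hn
          rw [Finset.mem_Icc] at hn
          conv_lhs => rw [← (hF n hn.1).2.2.1]
          push_cast
          rw [mul_inv]
      _ ≤ _ := by
          apply Finset.sum_le_sum_of_subset_of_nonneg
          · intro q hq
            obtain ⟨n, hn, rfl⟩ := Finset.mem_image.mp hq
            rw [Finset.mem_Icc] at hn
            obtain ⟨h1, h2, h3, h4⟩ := hF n hn.1
            simp only [Finset.mem_product, Finset.mem_filter, Finset.mem_Icc]
            refine ⟨⟨h2, ?_⟩, ⟨h1, ?_⟩, h4⟩
            · nlinarith
            · exact (Nat.le_of_dvd hn.1 (Dvd.intro_left _ h3)).trans hn.2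
          · intros; positivity
  have h4 := sum_inv_sq_le R
  have h5 : 0 ≤ ∑ e ∈ (Icc 1 R).filter Squarefree, (e : ℝ)⁻¹ := by positivity
  nlinarith

lemma selberg_weights (R : ℕ) (hR : 1 ≤ R) :
    ∃ lam : ℕ → ℝ, lam 1 = 1 ∧ (∀ d ∈ Icc 1 R, |lam d| ≤ R) ∧
      ∑ d ∈ Icc 1 R, ∑ d' ∈ Icc 1 R, lam d * lam d' / (Nat.lcm d d' : ℝ)
        ≤ 2 / Real.log (R + 1) := by
  have hlog : 0 < Real.log (R + 1) := Real.log_pos (by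
    have : (1 : ℝ) ≤ R := by exact_mod_cast hR
    linarith)
  have hLge := selL_ge R
  have hL : 0 < selL R := by linarith
  set mu : ℕ → ℝ := fun n => ((ArithmeticFunction.moebius n : ℤ) : ℝ) with hmu
  set y : ℕ → ℝ := fun e => mu e / (Nat.totient e * selL R) with hy
  set w : ℕ → ℝ := fun d => ∑ e ∈ Icc 1 R, (if d ∣ e then mu (e / d) * y e else 0) with hw
  have hmu1 : ∀ n, |mu n| ≤ 1 := by
    intro n
    have := ArithmeticFunction.abs_moebius_le_one (n := n)
    simp only [hmu]
    exact_mod_cast this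
  have hmuabs : ∀ n, |mu n| = mu n ^ 2 := by
    intro n
    rcases ArithmeticFunction.moebius_eq_or n with h | h | h <;> simp [hmu, h]
  have hysum : ∑ e ∈ Icc 1 R, |y e| = 1 := by
    have : ∀ e ∈ Icc 1 R, |y e| = (mu e ^ 2 / (Nat.totient e : ℝ)) / selL R := by
      intro e _
      simp only [hy]
      rw [abs_div, hmuabs, abs_of_nonneg (by positivity), div_div]
    rw [Finset.sum_congr rfl this, ← Finset.sum_div]
    exact div_self hL.ne'
  have hinv : ∀ e ∈ Icc 1 R, ∑ d ∈ Icc 1 R, (if e ∣ d then w d else 0) = y e := by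
    intro e he
    have : ∀ d ∈ Icc 1 R, (if e ∣ d then w d else 0)
        = ∑ f ∈ Icc 1 R, y f * (((if e ∣ d ∧ d ∣ f then (ArithmeticFunction.moebius (f / d) : ℤ) else 0) : ℤ) : ℝ) := by
      intro d _
      by_cases h : e ∣ d
      · simp only [h, if_true, true_and, hw]
        apply Finset.sum_congr rfl
        intro f _
        split_ifs
        · simp only [hmu]; ring
        · simp
      · simp [h]
    rw [Finset.sum_congr rfl this, Finset.sum_comm]
    have h2 : ∀ f ∈ Icc 1 R, ∑ d ∈ Icc 1 R, y f * (((if e ∣ d ∧ d ∣ f then (ArithmeticFunction.moebius (f / d) : ℤ) else 0) : ℤ) : ℝ) = if e = f then y f else 0 := by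
      intro f hf
      rw [← Finset.mul_sum, ← Int.cast_sum, sum_mu_between R e f he hf]
      split_ifs <;> simp
    rw [Finset.sum_congr rfl h2, Finset.sum_ite_eq, if_pos he]
  refine ⟨fun d => d * w d, ?_, ?_, ?_⟩
  · simp only [hw, Nat.cast_one, one_mul, one_dvd, if_true, Nat.div_one]
    have : ∀ e ∈ Icc 1 R, mu e * y e = (mu e ^ 2 / (Nat.totient e : ℝ)) / selL R := by
      intro e _
      simp only [hy]
      rw [div_div]; ring
    rw [Finset.sum_congr rfl this, ← Finset.sum_div]
    exact div_self hL.ne'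
  · intro d hd
    rw [Finset.mem_Icc] at hd
    have : |w d| ≤ 1 := by
      rw [← hysum]
      refine (Finset.abs_sum_le_sum_abs _ _).trans (Finset.sum_le_sum fun e _ => ?_)
      split_ifs
      · rw [abs_mul]
        exact mul_le_of_le_one_left (abs_nonneg _) (hmu1 _)
      · simp
    rw [abs_mul, Nat.abs_cast]
    have h2 : (d : ℝ) ≤ R := by exact_mod_cast hd.2
    nlinarith [abs_nonneg (w d), (Nat.cast_nonneg d : (0 : ℝ) ≤ d)]
  · have hterm : ∀ d ∈ Icc 1 R, ∀ d' ∈ Icc 1 R,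
        (d * w d) * (d' * w d') / (Nat.lcm d d' : ℝ)
          = ∑ e ∈ Icc 1 R, (Nat.totient e : ℝ) *
            ((if e ∣ d then w d else 0) * (if e ∣ d' then w d' else 0)) := by
      intro d hd d' hd'
      rw [Finset.mem_Icc] at hd hd'
      have hgcd : ((Nat.gcd d d' : ℕ) : ℝ) = ∑ e ∈ Icc 1 R, (if e ∣ d ∧ e ∣ d' then (Nat.totient e : ℝ) else 0) := by
        conv_lhs => rw [← Nat.sum_totient (Nat.gcd d d')]
        rw [Nat.cast_sum, ← Finset.sum_filter]
        apply Finset.sum_congr _ (fun _ _ => rfl)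
        ext e
        simp only [Nat.mem_divisors, Finset.mem_filter, Finset.mem_Icc, Nat.dvd_gcd_iff]
        constructor
        · rintro ⟨⟨h1, h2⟩, _⟩
          exact ⟨⟨Nat.pos_of_dvd_of_pos h1 hd.1, (Nat.le_of_dvd hd.1 h1).trans hd.2⟩, h1, h2⟩
        · rintro ⟨_, h1, h2⟩
          exact ⟨⟨h1, h2⟩, (Nat.gcd_pos_of_pos_left _ hd.1).ne'⟩
      have hl : (Nat.gcd d d' : ℝ) * (Nat.lcm d d' : ℝ) = d * d' := by
        exact_mod_cast Nat.gcd_mul_lcm d d'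
      have hlp : (Nat.lcm d d' : ℝ) ≠ 0 := by
        exact_mod_cast (Nat.lcm_pos hd.1 hd'.1).ne'
      have : (d * w d) * (d' * w d') / (Nat.lcm d d' : ℝ) = (Nat.gcd d d' : ℝ) * (w d * w d') := by
        rw [div_eq_iff hlp]
        calc _ = (d * d' : ℝ) * (w d * w d') := by ring
          _ = _ := by rw [← hl]; ring
      rw [this, hgcd, Finset.sum_mul]
      apply Finset.sum_congr rfl
      intro e _
      by_cases h1 : e ∣ d <;> by_cases h2 : e ∣ d' <;> simp [h1, h2]
    have : ∑ d ∈ Icc 1 R, ∑ d' ∈ Icc 1 R, (d * w d) * (d' * w d') / (Nat.lcm d d' : ℝ)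
        = ∑ e ∈ Icc 1 R, (Nat.totient e : ℝ) * y e ^ 2 := by
      rw [Finset.sum_congr rfl fun d hd => Finset.sum_congr rfl fun d' hd' => hterm d hd d' hd']
      rw [Finset.sum_congr rfl fun d hd => Finset.sum_comm, Finset.sum_comm]
      apply Finset.sum_congr rfl
      intro e he
      rw [← hinv e he, sq, Finset.sum_mul_sum, Finset.mul_sum]
      apply Finset.sum_congr rfl
      intro d _
      rw [Finset.mul_sum]
    rw [this]
    have h3 : ∀ e ∈ Icc 1 R, (Nat.totient e : ℝ) * y e ^ 2 = (mu e ^ 2 / (Nat.totient e : ℝ)) / selL R ^ 2 := by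
      intro e he
      rw [Finset.mem_Icc] at he
      have : (Nat.totient e : ℝ) ≠ 0 := by exact_mod_cast (Nat.totient_pos.mpr he.1).ne'
      simp only [hy]
      field_simp
    rw [Finset.sum_congr rfl h3, ← Finset.sum_div]
    change selL R / selL R ^ 2 ≤ _
    rw [div_le_div_iff₀ (by positivity) hlog]
    nlinarith


/-! Part 3: divisor bound, square products -/

lemma divisor_bound (δ : ℝ) (hδ : 0 < δ) :
    ∃ C : ℝ, 0 < C ∧ ∀ n : ℕ, n ≠ 0 → (n.divisors.card : ℝ) ≤ C * (n : ℝ) ^ δ := by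
  have hl2 : 0 < Real.log 2 := Real.log_pos (by norm_num)
  set C0 : ℝ := 1 + 1 / (δ * Real.log 2) with hC0
  have hC01 : 1 ≤ C0 := by
    have : 0 < 1 / (δ * Real.log 2) := by positivity
    linarith
  set P : ℕ := ⌈(2 : ℝ) ^ (1 / δ)⌉₊ with hP
  refine ⟨C0 ^ P, by positivity, ?_⟩
  intro n hn
  rw [Nat.card_divisors hn]
  have hn' : (n : ℝ) ^ δ = ∏ p ∈ n.primeFactors, ((p : ℝ) ^ (n.factorization p)) ^ δ := by
    rw [Real.finsetProd_rpow _ _ (fun i _ => by positivity)]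
    congr 1
    conv_lhs => rw [← Nat.prod_factorization_pow_eq_self hn]
    rw [Finsupp.prod, Nat.support_factorization]
    push_cast
    rfl
  have hfac : ∀ p ∈ n.primeFactors, ((n.factorization p + 1 : ℕ) : ℝ)
      ≤ (if p < P then C0 else 1) * ((p : ℝ) ^ (n.factorization p)) ^ δ := by
    intro p hp
    have hpp := Nat.prime_of_mem_primeFactors hp
    set a := n.factorization p
    have hp2 : (2 : ℝ) ≤ p := by exact_mod_cast hpp.two_le
    split_ifs with h
    · have h1 : ((2 : ℝ) ^ a) ^ δ ≤ ((p : ℝ) ^ a) ^ δ := by gcongr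
      have h2 : ((2 : ℝ) ^ a) ^ δ = Real.exp (a * (δ * Real.log 2)) := by
        rw [← Real.rpow_natCast, ← Real.rpow_mul (by norm_num), Real.rpow_def_of_pos (by norm_num)]
        ring_nf
      have h3 := Real.add_one_le_exp (a * (δ * Real.log 2))
      have h4 : ((a + 1 : ℕ) : ℝ) ≤ C0 * (a * (δ * Real.log 2) + 1) := by
        have e : C0 * (a * (δ * Real.log 2) + 1) = a * (δ * Real.log 2) + 1 + a + 1 / (δ * Real.log 2) := by
          rw [hC0]; field_simp; ring
        rw [e]; push_cast
        have : 0 < 1 / (δ * Real.log 2) := by positivity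
        have : 0 ≤ a * (δ * Real.log 2) := by positivity
        linarith
      calc ((a + 1 : ℕ) : ℝ) ≤ C0 * (a * (δ * Real.log 2) + 1) := h4
        _ ≤ C0 * ((p : ℝ) ^ a) ^ δ := by
          apply mul_le_mul_of_nonneg_left _ (by linarith)
          linarith
    · have hPp : (2 : ℝ) ^ (1 / δ) ≤ p := by
        refine (Nat.le_ceil _).trans ?_
        exact_mod_cast not_lt.mp h
      have h1 : (2 : ℝ) ≤ (p : ℝ) ^ δ := by
        calc (2 : ℝ) = ((2 : ℝ) ^ (1 / δ)) ^ δ := by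
              rw [← Real.rpow_mul (by norm_num), one_div_mul_cancel hδ.ne', Real.rpow_one]
          _ ≤ _ := by gcongr
      have h2 : ((p : ℝ) ^ a) ^ δ = ((p : ℝ) ^ δ) ^ a := by
        rw [← Real.rpow_natCast, ← Real.rpow_mul (by positivity), mul_comm, Real.rpow_mul (by positivity),
          Real.rpow_natCast]
      rw [one_mul, h2]
      calc ((a + 1 : ℕ) : ℝ) ≤ (2 : ℝ) ^ a := by exact_mod_cast Nat.lt_two_pow_self
        _ ≤ _ := by gcongr
  have hprod : ∏ p ∈ n.primeFactors, (if p < P then C0 else 1) ≤ C0 ^ P := by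
    rw [← Finset.prod_filter, Finset.prod_const]
    apply pow_le_pow_right₀ hC01
    calc #{p ∈ n.primeFactors | p < P} ≤ (range P).card := by
          apply Finset.card_le_card
          intro p hp
          exact Finset.mem_range.mpr (Finset.mem_filter.mp hp).2
      _ = P := by simp
  rw [hn', Nat.cast_prod]
  refine (Finset.prod_le_prod (fun _ _ => by positivity) hfac).trans ?_
  rw [Finset.prod_mul_distrib]
  apply mul_le_mul_of_nonneg_right hprod
  positivity

lemma sq_param (u v : ℕ) (hu : u ≠ 0) (h : IsSquare (u * v)) :
    ∃ g a b, u = g * a ^ 2 ∧ v = g * b ^ 2 := by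
  obtain ⟨g, u', v', hg, hcop, hu', hv'⟩ := Nat.exists_coprime' (m := u) (n := v)
    (Nat.gcd_pos_of_pos_left _ (Nat.pos_of_ne_zero hu))
  obtain ⟨w, hw⟩ := h
  have h1 : g ^ 2 * (u' * v') = w ^ 2 := by
    rw [sq w, ← hw, hu', hv']; ring
  have h2 : g ∣ w := by
    rw [← Nat.pow_dvd_pow_iff (two_ne_zero)]
    exact Dvd.intro _ h1
  obtain ⟨z, rfl⟩ := h2
  have h3 : u' * v' = z ^ 2 := by
    apply Nat.eq_of_mul_eq_mul_left (pow_pos hg 2)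
    rw [h1]; ring
  obtain ⟨a, ha⟩ := exists_eq_pow_of_mul_eq_pow (Nat.isUnit_iff.mpr hcop) h3
  obtain ⟨b, hb⟩ := exists_eq_pow_of_mul_eq_pow (Nat.isUnit_iff.mpr hcop.symm) (by rw [mul_comm]; exact h3)
  exact ⟨g, a, b, by rw [hu', ha]; ring, by rw [hv', hb]; ring⟩

lemma card_sq_pairs (U : ℕ) :
    (((Icc 1 U ×ˢ Icc 1 U).filter (fun q => IsSquare (q.1 * q.2))).card : ℝ)
      ≤ U * (1 + Real.log U) := by
  have hsub : (Icc 1 U ×ˢ Icc 1 U).filter (fun q => IsSquare (q.1 * q.2))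
      ⊆ ((Icc 1 U).sigma fun g => Icc 1 (Nat.sqrt (U / g)) ×ˢ Icc 1 (Nat.sqrt (U / g))).image
        (fun t => (t.1 * t.2.1 ^ 2, t.1 * t.2.2 ^ 2)) := by
    rintro ⟨u, v⟩ hq
    simp only [Finset.mem_filter, Finset.mem_product, Finset.mem_Icc] at hq
    obtain ⟨⟨⟨hu1, hu2⟩, hv1, hv2⟩, hs⟩ := hq
    obtain ⟨g, a, b, rfl, rfl⟩ := sq_param u v (by omega) hs
    have hg : 0 < g := Nat.pos_of_ne_zero (by rintro rfl; simp at hu1)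
    have ha : 0 < a := Nat.pos_of_ne_zero (by rintro rfl; simp at hu1)
    have hb : 0 < b := Nat.pos_of_ne_zero (by rintro rfl; simp at hv1)
    rw [Finset.mem_image]
    refine ⟨⟨g, (a, b)⟩, ?_, rfl⟩
    simp only [Finset.mem_sigma, Finset.mem_product, Finset.mem_Icc]
    refine ⟨⟨hg, ?_⟩, ⟨ha, ?_⟩, hb, ?_⟩
    · exact (Nat.le_mul_of_pos_right g (pow_pos ha 2)).trans hu2
    · rw [Nat.le_sqrt', Nat.le_div_iff_mul_le hg, mul_comm]; exact hu2
    · rw [Nat.le_sqrt', Nat.le_div_iff_mul_le hg, mul_comm]; exact hv2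
  have h1 := (Finset.card_le_card hsub).trans Finset.card_image_le
  rw [Finset.card_sigma] at h1
  calc (((Icc 1 U ×ˢ Icc 1 U).filter (fun q => IsSquare (q.1 * q.2))).card : ℝ)
      ≤ ∑ g ∈ Icc 1 U, ((Icc 1 (Nat.sqrt (U / g)) ×ˢ Icc 1 (Nat.sqrt (U / g))).card : ℝ) := by
        exact_mod_cast h1
    _ ≤ ∑ g ∈ Icc 1 U, (U : ℝ) * (g : ℝ)⁻¹ := by
        apply Finset.sum_le_sum
        intro g _
        rw [Finset.card_product, Nat.card_Icc, Nat.add_sub_cancel]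
        have : Nat.sqrt (U / g) * Nat.sqrt (U / g) ≤ U / g := Nat.sqrt_le _
        calc ((Nat.sqrt (U / g) * Nat.sqrt (U / g) : ℕ) : ℝ) ≤ ((U / g : ℕ) : ℝ) := by exact_mod_cast this
          _ ≤ (U : ℝ) / g := Nat.cast_div_le
          _ = _ := by rw [div_eq_mul_inv]
    _ = U * (harmonic U : ℝ) := by rw [← Finset.mul_sum, harmonic_real]
    _ ≤ _ := by
        apply mul_le_mul_of_nonneg_left (harmonic_le_one_add_log U) (by positivity)

/-- quadruples from `{1..m}`. -/
def quads (m : ℕ) : Finset ((ℕ × ℕ) × (ℕ × ℕ)) :=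
  (Icc 1 m ×ˢ Icc 1 m) ×ˢ (Icc 1 m ×ˢ Icc 1 m)

def qprod (t : (ℕ × ℕ) × (ℕ × ℕ)) : ℕ := (t.1.1 * t.1.2) * (t.2.1 * t.2.2)

lemma card_quads_sq :
    ∃ C : ℝ, 0 < C ∧ ∀ m : ℕ, 1 ≤ m →
      (((quads m).filter (fun t => IsSquare (qprod t))).card : ℝ) ≤ C * (m : ℝ) ^ (5 / 2 : ℝ) := by
  obtain ⟨C, hC, hd⟩ := divisor_bound (1 / 16) (by norm_num)
  refine ⟨C ^ 2 * 9, by positivity, ?_⟩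
  intro m hm
  have hm' : (1 : ℝ) ≤ m := by exact_mod_cast hm
  set T := (Icc 1 (m ^ 2) ×ˢ Icc 1 (m ^ 2)).filter (fun q => IsSquare (q.1 * q.2)) with hT
  set A := (quads m).filter (fun t => IsSquare (qprod t)) with hA
  have hmaps : ∀ t ∈ A, ((t.1.1 * t.1.2, t.2.1 * t.2.2) : ℕ × ℕ) ∈ T := by
    rintro ⟨⟨a, b⟩, c, d⟩ ht
    rw [hA, Finset.mem_filter] at ht
    rw [hT, Finset.mem_filter]
    simp only [quads, qprod, Finset.mem_product, Finset.mem_Icc] at ht ⊢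
    obtain ⟨⟨⟨⟨a1, a2⟩, b1, b2⟩, ⟨c1, c2⟩, d1, d2⟩, hs⟩ := ht
    refine ⟨⟨⟨Nat.mul_pos a1 b1, ?_⟩, Nat.mul_pos c1 d1, ?_⟩, hs⟩
    · rw [sq]; exact Nat.mul_le_mul a2 b2
    · rw [sq]; exact Nat.mul_le_mul c2 d2
  have hdu : ∀ u ∈ Icc 1 (m ^ 2), (u.divisors.card : ℝ) ≤ C * (m : ℝ) ^ (1 / 8 : ℝ) := by
    intro u hu
    rw [Finset.mem_Icc] at hu
    refine (hd u (by omega)).trans ?_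
    apply mul_le_mul_of_nonneg_left _ hC.le
    calc (u : ℝ) ^ (1 / 16 : ℝ) ≤ ((m : ℝ) ^ 2) ^ (1 / 16 : ℝ) := by
          gcongr; exact_mod_cast hu.2
      _ = (m : ℝ) ^ (1 / 8 : ℝ) := by
          rw [← Real.rpow_natCast, ← Real.rpow_mul (by positivity)]; norm_num
  have hfib : ∀ q ∈ T, ((A.filter (fun t => ((t.1.1 * t.1.2, t.2.1 * t.2.2) : ℕ × ℕ) = q)).card : ℝ)
      ≤ C ^ 2 * (m : ℝ) ^ (1 / 4 : ℝ) := by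
    rintro ⟨u, v⟩ hq
    simp only [hT, Finset.mem_filter, Finset.mem_product] at hq
    obtain ⟨⟨hu, hv⟩, _⟩ := hq
    have hu0 : u ≠ 0 := by rw [Finset.mem_Icc] at hu; omega
    have hv0 : v ≠ 0 := by rw [Finset.mem_Icc] at hv; omega
    have hcard : (A.filter (fun t => ((t.1.1 * t.1.2, t.2.1 * t.2.2) : ℕ × ℕ) = (u, v))).card
        ≤ (u.divisors ×ˢ v.divisors).card := by
      apply Finset.card_le_card_of_injOn (fun t => (t.1.1, t.2.1))
      · rintro ⟨⟨a, b⟩, c, d⟩ ht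
        simp only [Finset.coe_filter, Set.mem_ofPred_eq, Prod.mk.injEq] at ht
        simp only [Finset.coe_product, Set.mem_prod, Finset.mem_coe, Nat.mem_divisors]
        exact ⟨⟨Dvd.intro _ ht.2.1, hu0⟩, Dvd.intro _ ht.2.2, hv0⟩
      · rintro ⟨⟨a, b⟩, c, d⟩ ht ⟨⟨a', b'⟩, c', d'⟩ ht' heq
        simp only [Finset.coe_filter, Set.mem_ofPred_eq, Prod.mk.injEq] at ht ht' heq
        obtain ⟨rfl, rfl⟩ := heq
        have ha : 0 < a := Nat.pos_of_ne_zero (by rintro rfl; simp at ht; omega)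
        have hc : 0 < c := Nat.pos_of_ne_zero (by rintro rfl; simp at ht; omega)
        have e1 : b = b' := Nat.eq_of_mul_eq_mul_left ha (ht.2.1.trans ht'.2.1.symm)
        have e2 : d = d' := Nat.eq_of_mul_eq_mul_left hc (ht.2.2.trans ht'.2.2.symm)
        rw [e1, e2]
    rw [Finset.card_product] at hcard
    calc _ ≤ ((u.divisors.card * v.divisors.card : ℕ) : ℝ) := by exact_mod_cast hcard
      _ = (u.divisors.card : ℝ) * v.divisors.card := by push_cast; ring
      _ ≤ (C * (m : ℝ) ^ (1 / 8 : ℝ)) * (C * (m : ℝ) ^ (1 / 8 : ℝ)) :=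
          mul_le_mul (hdu u hu) (hdu v hv) (by positivity) (by positivity)
      _ = C ^ 2 * ((m : ℝ) ^ (1 / 8 : ℝ) * (m : ℝ) ^ (1 / 8 : ℝ)) := by ring
      _ = _ := by rw [← Real.rpow_add (by positivity)]; norm_num
  have hsum : (A.card : ℝ) ≤ T.card * (C ^ 2 * (m : ℝ) ^ (1 / 4 : ℝ)) := by
    rw [Finset.card_eq_sum_card_fiberwise hmaps]
    push_cast
    rw [← nsmul_eq_mul]
    exact Finset.sum_le_card_nsmul _ _ _ hfib
  have hTc : (T.card : ℝ) ≤ (m : ℝ) ^ 2 * (9 * (m : ℝ) ^ (1 / 4 : ℝ)) := by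
    refine (card_sq_pairs (m ^ 2)).trans ?_
    push_cast
    apply mul_le_mul_of_nonneg_left _ (by positivity)
    rw [Real.log_pow]
    have h1 := Real.log_le_rpow_div (x := (m : ℝ)) (by positivity) (ε := 1 / 4) (by norm_num)
    have h2 : 1 ≤ (m : ℝ) ^ (1 / 4 : ℝ) := Real.one_le_rpow hm' (by norm_num)
    push_cast
    linarith
  calc (A.card : ℝ) ≤ T.card * (C ^ 2 * (m : ℝ) ^ (1 / 4 : ℝ)) := hsum
    _ ≤ ((m : ℝ) ^ 2 * (9 * (m : ℝ) ^ (1 / 4 : ℝ))) * (C ^ 2 * (m : ℝ) ^ (1 / 4 : ℝ)) := by gcongr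
    _ = C ^ 2 * 9 * ((m : ℝ) ^ (2 : ℝ) * (m : ℝ) ^ (1 / 4 : ℝ) * (m : ℝ) ^ (1 / 4 : ℝ)) := by
        rw [Real.rpow_two]; ring
    _ = _ := by
        rw [← Real.rpow_add (by positivity), ← Real.rpow_add (by positivity)]; norm_num


/-! Part 4: the sieve moment bound -/

def hodd (u q : ℕ) : ℤ := if Odd q then jacobiSym u q else 0

lemma hodd_abs_le (u q : ℕ) : |hodd u q| ≤ 1 := by
  unfold hodd; split_ifs
  · exact jac_abs_le _ _
  · simp

lemma sum_hodd_dvd (u : ℕ) (hu : u ≠ 0) (hs : ¬ IsSquare u) (D X : ℕ) (hD : 0 < D) :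
    |∑ q ∈ range (X + 1), (if D ∣ q then hodd u q else 0)| ≤ 4 * u := by
  have h1 : ∑ q ∈ range (X + 1), (if D ∣ q then hodd u q else 0)
      = ∑ q ∈ range (X / D + 1), hodd u (D * q) := by
    rw [← Finset.sum_filter]
    symm
    apply Finset.sum_bij (fun q _ => D * q)
    · intro q hq
      rw [Finset.mem_range, Nat.lt_succ_iff, Nat.le_div_iff_mul_le hD, mul_comm] at hq
      rw [Finset.mem_filter, Finset.mem_range]
      exact ⟨Nat.lt_succ_of_le hq, Dvd.intro _ rfl⟩
    · intro a _ b _ hab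
      exact Nat.eq_of_mul_eq_mul_left hD hab
    · intro q hq
      rw [Finset.mem_filter, Finset.mem_range] at hq
      obtain ⟨hq, q', rfl⟩ := hq
      refine ⟨q', ?_, rfl⟩
      rw [Finset.mem_range, Nat.lt_succ_iff, Nat.le_div_iff_mul_le hD, mul_comm]
      omega
    · intros; rfl
  have h2 : ∀ q, hodd u (D * q) = hodd u D * hodd u q := by
    intro q
    unfold hodd
    by_cases ha : Odd D <;> by_cases hb : Odd q <;> simp [ha, hb, Nat.odd_mul]
    exact jacobiSym.mul_right' _ ha.pos.ne' hb.pos.ne'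
  rw [h1, Finset.sum_congr rfl (fun q _ => h2 q), ← Finset.mul_sum, abs_mul]
  have h3 : |∑ q ∈ range (X / D + 1), hodd u q| ≤ 4 * u := sum_odd_jac u hu hs (X / D + 1)
  have h4 := hodd_abs_le u D
  nlinarith [abs_nonneg (∑ q ∈ range (X / D + 1), hodd u q)]

def wt (lam : ℕ → ℝ) (R q : ℕ) : ℝ := (∑ d ∈ Icc 1 R, if d ∣ q then lam d else 0) ^ 2

lemma wt_eq (lam : ℕ → ℝ) (R q : ℕ) :
    wt lam R q = ∑ d ∈ Icc 1 R, ∑ d' ∈ Icc 1 R,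
      lam d * lam d' * (if Nat.lcm d d' ∣ q then 1 else 0) := by
  rw [wt, sq, Finset.sum_mul_sum]
  apply Finset.sum_congr rfl; intro d _
  apply Finset.sum_congr rfl; intro d' _
  simp only [Nat.lcm_dvd_iff]
  by_cases h1 : d ∣ q <;> by_cases h2 : d' ∣ q <;> simp [h1, h2]

lemma wt_sum_general (lam : ℕ → ℝ) (R : ℕ) (s : Finset ℕ) (g : ℕ → ℝ) :
    ∑ q ∈ s, wt lam R q * g q = ∑ d ∈ Icc 1 R, ∑ d' ∈ Icc 1 R,
      lam d * lam d' * ∑ q ∈ s, (if Nat.lcm d d' ∣ q then g q else 0) := by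
  simp only [wt_eq, Finset.sum_mul, Finset.mul_sum]
  rw [Finset.sum_comm]
  apply Finset.sum_congr rfl; intro d _
  rw [Finset.sum_comm]
  apply Finset.sum_congr rfl; intro d' _
  apply Finset.sum_congr rfl; intro q _
  split_ifs <;> ring

lemma lam_sum_bound (lam : ℕ → ℝ) (R : ℕ) (hl : ∀ d ∈ Icc 1 R, |lam d| ≤ R) (f : ℕ → ℕ → ℝ)
    (B : ℝ) (hf : ∀ d ∈ Icc 1 R, ∀ d' ∈ Icc 1 R, |f d d'| ≤ B) :
    |∑ d ∈ Icc 1 R, ∑ d' ∈ Icc 1 R, lam d * lam d' * f d d'| ≤ (R : ℝ) ^ 4 * B := by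
  calc |∑ d ∈ Icc 1 R, ∑ d' ∈ Icc 1 R, lam d * lam d' * f d d'|
      ≤ ∑ d ∈ Icc 1 R, ∑ d' ∈ Icc 1 R, |lam d * lam d' * f d d'| :=
        (Finset.abs_sum_le_sum_abs _ _).trans
          (Finset.sum_le_sum fun d _ => Finset.abs_sum_le_sum_abs _ _)
    _ ≤ ∑ d ∈ Icc 1 R, ∑ d' ∈ Icc 1 R, ((R : ℝ) * R * B) := by
        apply Finset.sum_le_sum; intro d hd
        apply Finset.sum_le_sum; intro d' hd'
        rw [abs_mul, abs_mul]
        exact mul_le_mul (mul_le_mul (hl d hd) (hl d' hd') (abs_nonneg _) (by positivity))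
          (hf d hd d' hd') (abs_nonneg _) (by positivity)
    _ = (R : ℝ) ^ 4 * B := by
        simp only [Finset.sum_const, Nat.card_Icc, Nat.add_sub_cancel, nsmul_eq_mul]
        ring

lemma wt_sum_diag (lam : ℕ → ℝ) (R X : ℕ) (hl : ∀ d ∈ Icc 1 R, |lam d| ≤ R)
    (hq : ∑ d ∈ Icc 1 R, ∑ d' ∈ Icc 1 R, lam d * lam d' / (Nat.lcm d d' : ℝ)
        ≤ 2 / Real.log (R + 1)) :
    ∑ q ∈ Ioc 0 X, wt lam R q ≤ X * (2 / Real.log (R + 1)) + (R : ℝ) ^ 4 := by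
  have h1 : ∑ q ∈ Ioc 0 X, wt lam R q = ∑ d ∈ Icc 1 R, ∑ d' ∈ Icc 1 R,
      lam d * lam d' * ((X / Nat.lcm d d' : ℕ) : ℝ) := by
    have := wt_sum_general lam R (Ioc 0 X) (fun _ => 1)
    simp only [mul_one] at this
    rw [this]
    apply Finset.sum_congr rfl; intro d _
    apply Finset.sum_congr rfl; intro d' _
    rw [← Nat.Ioc_filter_dvd_card_eq_div, ← Finset.sum_filter]
    simp
  have h2 : ∑ q ∈ Ioc 0 X, wt lam R q
      = X * (∑ d ∈ Icc 1 R, ∑ d' ∈ Icc 1 R, lam d * lam d' / (Nat.lcm d d' : ℝ))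
        + ∑ d ∈ Icc 1 R, ∑ d' ∈ Icc 1 R,
          lam d * lam d' * (((X / Nat.lcm d d' : ℕ) : ℝ) - (X : ℝ) / (Nat.lcm d d' : ℝ)) := by
    rw [h1, Finset.mul_sum, ← Finset.sum_add_distrib]
    apply Finset.sum_congr rfl; intro d _
    rw [Finset.mul_sum, ← Finset.sum_add_distrib]
    apply Finset.sum_congr rfl; intro d' _
    ring
  have h3 := lam_sum_bound lam R hl
    (fun d d' => ((X / Nat.lcm d d' : ℕ) : ℝ) - (X : ℝ) / (Nat.lcm d d' : ℝ)) 1 (by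
      intro d hd d' hd'
      have e1 : ((X / Nat.lcm d d' : ℕ) : ℝ) ≤ (X : ℝ) / (Nat.lcm d d' : ℝ) := Nat.cast_div_le
      have e2 : (X : ℝ) / (Nat.lcm d d' : ℝ) < ((X / Nat.lcm d d' : ℕ) : ℝ) + 1 := by
        rw [← Nat.floor_div_eq_div (K := ℝ)]
        exact Nat.lt_floor_add_one _
      rw [abs_le]; constructor <;> linarith)
  have h4 := (abs_le.mp h3).2
  rw [h2]
  have h5 := mul_le_mul_of_nonneg_left hq (Nat.cast_nonneg X : (0 : ℝ) ≤ X)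
  linarith

lemma S_pow_four (m q : ℕ) : (S m q) ^ 4 = ∑ t ∈ quads m, jacobiSym (qprod t : ℕ) q := by
  have : (S m q) ^ 4 = ((S m q) * (S m q)) * ((S m q) * (S m q)) := by ring
  rw [this, S, Finset.sum_mul_sum, ← Finset.sum_product', Finset.sum_mul_sum, ← Finset.sum_product',
    quads]
  apply Finset.sum_congr rfl
  intro t _
  simp only [qprod]
  push_cast
  simp only [jacobiSym.mul_left]

lemma medium_bound :
    ∃ C : ℝ, 0 < C ∧ ∀ (ε : ℝ) (_ : 0 < ε) (R m X : ℕ), 1 ≤ R → 1 ≤ m →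
      (((range (X + 1)).filter (fun p => (p.Prime ∧ p ≠ 2) ∧ ε * m ≤ (S m p : ℝ))).card : ℝ)
        * (ε * m) ^ 4 ≤
      R * (ε * m) ^ 4 + (C * (m : ℝ) ^ (5 / 2 : ℝ) * (X * (2 / Real.log (R + 1)) + (R : ℝ) ^ 4)
        + (m : ℝ) ^ 4 * ((R : ℝ) ^ 4 * (4 * (m : ℝ) ^ 4))) := by
  obtain ⟨C, hC, hquad⟩ := card_quads_sq
  refine ⟨C, hC, ?_⟩
  intro ε hε R m X hR hm
  obtain ⟨lam, hl1, hlb, hlq⟩ := selberg_weights R hR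
  set E := (range (X + 1)).filter (fun p => (p.Prime ∧ p ≠ 2) ∧ ε * m ≤ (S m p : ℝ)) with hE
  set G : ℝ := X * (2 / Real.log (R + 1)) + (R : ℝ) ^ 4 with hG
  have hwt0 : ∀ q, 0 ≤ wt lam R q := fun q => sq_nonneg _
  have hdiag := wt_sum_diag lam R X hlb hlq
  have hG0 : 0 ≤ G := le_trans (Finset.sum_nonneg fun q _ => hwt0 q) hdiag
  -- step 1
  have hcard : (E.card : ℝ) ≤ R + ((E.filter (fun p => R < p)).card : ℝ) := by
    have h := Finset.card_filter_add_card_filter_not (s := E) (fun p => R < p)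
    have h2 : (E.filter (fun p => ¬ R < p)).card ≤ R := by
      calc _ ≤ (Icc 1 R).card := by
            apply Finset.card_le_card
            intro p hp
            rw [Finset.mem_filter, hE, Finset.mem_filter] at hp
            rw [Finset.mem_Icc]
            exact ⟨hp.1.2.1.1.pos, not_lt.mp hp.2⟩
        _ = R := by simp
    have h3 : E.card ≤ R + (E.filter (fun p => R < p)).card := by omega
    exact_mod_cast h3
  have hem : 0 ≤ (ε * m) ^ 4 := by positivity
  set V : ℝ := ∑ q ∈ range (X + 1), wt lam R q * (if Odd q then ((S m q : ℤ) : ℝ) ^ 4 else 0) with hV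
  have hstep1 : ((E.filter (fun p => R < p)).card : ℝ) * (ε * m) ^ 4 ≤ V := by
    calc ((E.filter (fun p => R < p)).card : ℝ) * (ε * m) ^ 4
        = ∑ q ∈ E.filter (fun p => R < p), (ε * m) ^ 4 := by
          rw [Finset.sum_const, nsmul_eq_mul]
      _ ≤ ∑ q ∈ E.filter (fun p => R < p), wt lam R q * (if Odd q then ((S m q : ℤ) : ℝ) ^ 4 else 0) := by
          apply Finset.sum_le_sum
          intro q hq
          rw [Finset.mem_filter, hE, Finset.mem_filter] at hq
          obtain ⟨⟨_, ⟨hqp, hq2⟩, hqS⟩, hRq⟩ := hq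
          have hw : wt lam R q = 1 := by
            rw [wt, Finset.sum_eq_single 1]
            · simp [hl1]
            · intro d hd hd1
              rw [Finset.mem_Icc] at hd
              rw [if_neg]
              intro hdq
              rcases (Nat.dvd_prime hqp).mp hdq with h | h <;> omega
            · intro h
              exact absurd (Finset.mem_Icc.mpr ⟨le_refl 1, hR⟩) h
          rw [hw, one_mul, if_pos (hqp.odd_of_ne_two hq2)]
          exact pow_le_pow_left₀ (by positivity) hqS 4
      _ ≤ V := by
          apply Finset.sum_le_sum_of_subset_of_nonneg
          · exact (Finset.filter_subset _ _).trans (Finset.filter_subset _ _)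
          · intro q _ _
            apply mul_nonneg (hwt0 q)
            split_ifs
            · exact Even.pow_nonneg (by decide) _
            · exact le_refl 0
  -- step 2
  have hVeq : V = ∑ t ∈ quads m, ∑ q ∈ range (X + 1), wt lam R q * (hodd (qprod t) q : ℝ) := by
    rw [hV, Finset.sum_comm]
    apply Finset.sum_congr rfl
    intro q _
    rw [← Finset.mul_sum]
    congr 1
    unfold hodd
    split_ifs with h
    · rw [← Int.cast_pow, S_pow_four, Int.cast_sum]
    · simp
  have hsq : ∀ t ∈ (quads m).filter (fun t => IsSquare (qprod t)),
      ∑ q ∈ range (X + 1), wt lam R q * (hodd (qprod t) q : ℝ) ≤ G := by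
    intro t _
    have h1 : ∑ q ∈ range (X + 1), wt lam R q * (hodd (qprod t) q : ℝ)
        = ∑ q ∈ Ioc 0 X, wt lam R q * (hodd (qprod t) q : ℝ) := by
      symm
      apply Finset.sum_subset
      · intro q hq
        rw [Finset.mem_Ioc] at hq
        rw [Finset.mem_range]; omega
      · intro q hq hq'
        rw [Finset.mem_range] at hq
        rw [Finset.mem_Ioc] at hq'
        have : q = 0 := by omega
        subst this
        simp [hodd]
    rw [h1]
    refine le_trans (Finset.sum_le_sum fun q _ => ?_) hdiag
    have h2 : ((hodd (qprod t) q : ℤ) : ℝ) ≤ 1 := by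
      exact_mod_cast (abs_le.mp (hodd_abs_le (qprod t) q)).2
    exact mul_le_of_le_one_right (hwt0 q) h2
  have hnsq : ∀ t ∈ (quads m).filter (fun t => ¬ IsSquare (qprod t)),
      ∑ q ∈ range (X + 1), wt lam R q * (hodd (qprod t) q : ℝ) ≤ (R : ℝ) ^ 4 * (4 * (m : ℝ) ^ 4) := by
    intro t ht
    rw [Finset.mem_filter] at ht
    obtain ⟨ht, hns⟩ := ht
    simp only [quads, Finset.mem_product, Finset.mem_Icc] at ht
    obtain ⟨⟨⟨a1, a2⟩, b1, b2⟩, ⟨c1, c2⟩, d1, d2⟩ := ht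
    have hpos : 0 < qprod t := Nat.mul_pos (Nat.mul_pos a1 b1) (Nat.mul_pos c1 d1)
    have hle : qprod t ≤ m ^ 4 := by
      calc qprod t ≤ (m * m) * (m * m) :=
            Nat.mul_le_mul (Nat.mul_le_mul a2 b2) (Nat.mul_le_mul c2 d2)
        _ = m ^ 4 := by ring
    rw [wt_sum_general]
    refine (le_abs_self _).trans (lam_sum_bound lam R hlb _ _ ?_)
    intro d hd d' hd'
    rw [Finset.mem_Icc] at hd hd'
    have h := sum_hodd_dvd (qprod t) hpos.ne' hns (Nat.lcm d d') X (Nat.lcm_pos hd.1 hd'.1)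
    have h' : |∑ q ∈ range (X + 1), (if Nat.lcm d d' ∣ q then (hodd (qprod t) q : ℝ) else 0)|
        ≤ 4 * (qprod t : ℝ) := by
      exact_mod_cast h
    refine h'.trans ?_
    have : (qprod t : ℝ) ≤ (m : ℝ) ^ 4 := by exact_mod_cast hle
    linarith
  have hVle : V ≤ C * (m : ℝ) ^ (5 / 2 : ℝ) * G + (m : ℝ) ^ 4 * ((R : ℝ) ^ 4 * (4 * (m : ℝ) ^ 4)) := by
    rw [hVeq, ← Finset.sum_filter_add_sum_filter_not (quads m) (fun t => IsSquare (qprod t))]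
    apply add_le_add
    · refine (Finset.sum_le_card_nsmul _ _ _ hsq).trans ?_
      rw [nsmul_eq_mul]
      exact mul_le_mul_of_nonneg_right (hquad m hm) hG0
    · refine (Finset.sum_le_card_nsmul _ _ _ hnsq).trans ?_
      rw [nsmul_eq_mul]
      apply mul_le_mul_of_nonneg_right _ (by positivity)
      have : ((quads m).filter (fun t => ¬ IsSquare (qprod t))).card ≤ m ^ 4 := by
        refine (Finset.card_filter_le _ _).trans ?_
        simp only [quads, Finset.card_product, Nat.card_Icc, Nat.add_sub_cancel]
        apply le_of_eq; ring
      exact_mod_cast this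
  calc (E.card : ℝ) * (ε * m) ^ 4 ≤ (R + ((E.filter (fun p => R < p)).card : ℝ)) * (ε * m) ^ 4 :=
        mul_le_mul_of_nonneg_right hcard hem
    _ = R * (ε * m) ^ 4 + ((E.filter (fun p => R < p)).card : ℝ) * (ε * m) ^ 4 := by ring
    _ ≤ _ := by linarith

theorem corr_sum (p : ℕ) [Fact p.Prime] (hp2 : p ≠ 2) (a b : ZMod p) (hab : a ≠ b) :
    ∑ c : ZMod p, quadraticChar (ZMod p) (c + a) * quadraticChar (ZMod p) (c + b) = -1 := by
  have hch : ringChar (ZMod p) ≠ 2 := by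
    rw [ZMod.ringChar_zmod_n]; exact hp2
  have hne := quadraticChar_ne_one hch
  have h1 := jacobiSum_nontrivial_inv hne
  rw [(quadraticChar_isQuadratic (ZMod p)).inv] at h1
  have hsub : a - b ≠ 0 := sub_ne_zero.mpr hab
  have e : ∑ c : ZMod p, quadraticChar (ZMod p) (c + a) * quadraticChar (ZMod p) (c + b)
      = ∑ x : ZMod p, quadraticChar (ZMod p) ((a-b)*x) * quadraticChar (ZMod p) (-((a-b)*(1-x))) := by
    refine (Fintype.sum_bijective (fun x : ZMod p => (a-b)*x - a) ?_ _ _ ?_).symm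
    · constructor
      · intro x y hxy
        have : (a-b)*x = (a-b)*y := by simpa using hxy
        exact mul_left_cancel₀ hsub this
      · intro y
        refine ⟨(y+a)/(a-b), ?_⟩
        field_simp
        ring
    · intro x
      congr 2 <;> ring
  rw [e]
  have h2 : quadraticChar (ZMod p) (a-b) ^ 2 = 1 := quadraticChar_sq_one hsub
  have h3 : quadraticChar (ZMod p) (-1) ^ 2 = 1 := quadraticChar_sq_one (by simp)
  have e2 : ∀ x : ZMod p, quadraticChar (ZMod p) ((a-b)*x) * quadraticChar (ZMod p) (-((a-b)*(1-x)))
     = quadraticChar (ZMod p) (-1) * (quadraticChar (ZMod p) x * quadraticChar (ZMod p) (1-x)) := by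
    intro x
    rw [neg_eq_neg_one_mul ((a-b)*(1-x)), map_mul, map_mul, map_mul]
    linear_combination (quadraticChar (ZMod p) (-1) * (quadraticChar (ZMod p) x * quadraticChar (ZMod p) (1-x))) * h2
  simp only [e2]
  rw [← Finset.mul_sum]
  unfold jacobiSum at h1
  rw [h1]
  linear_combination -h3

theorem qc_sq_sum (p : ℕ) [Fact p.Prime] (hp2 : p ≠ 2) (J : ℕ) (hJ : J ≤ p) :
    ∑ c : ZMod p, (∑ j ∈ range J, quadraticChar (ZMod p) (c + (j:ZMod p)))^2 ≤ (J * p : ℤ) := by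
  have e : ∑ c : ZMod p, (∑ j ∈ range J, quadraticChar (ZMod p) (c + (j:ZMod p)))^2
     = ∑ j ∈ range J, ∑ i ∈ range J, ∑ c : ZMod p,
        quadraticChar (ZMod p) (c + (j:ZMod p)) * quadraticChar (ZMod p) (c + (i:ZMod p)) := by
    simp only [sq, Finset.sum_mul_sum]
    rw [Finset.sum_comm]
    refine Finset.sum_congr rfl fun j _ => ?_
    rw [Finset.sum_comm]
  rw [e]
  have hb : ∀ j ∈ range J, ∑ i ∈ range J, ∑ c : ZMod p,
        quadraticChar (ZMod p) (c + (j:ZMod p)) * quadraticChar (ZMod p) (c + (i:ZMod p)) ≤ (p:ℤ) := by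
    intro j hj
    have : ∀ i ∈ range J, ∑ c : ZMod p,
        quadraticChar (ZMod p) (c + (j:ZMod p)) * quadraticChar (ZMod p) (c + (i:ZMod p)) ≤ if j = i then (p:ℤ) else 0 := by
      intro i hi
      split_ifs with h
      · subst h
        calc _ ≤ ∑ c : ZMod p, (1:ℤ) := by
              refine Finset.sum_le_sum fun c _ => ?_
              by_cases hc : c + (j:ZMod p) = 0
              · simp [hc]
              · have := quadraticChar_sq_one hc
                rw [sq] at this; rw [this]
          _ = p := by simp [ZMod.card]
      · rw [corr_sum p hp2]
        · norm_num
        · intro hh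
          rw [ZMod.natCast_eq_natCast_iff'] at hh
          simp only [Finset.mem_range] at hi hj
          rw [Nat.mod_eq_of_lt (by omega), Nat.mod_eq_of_lt (by omega)] at hh
          exact h hh
    refine (Finset.sum_le_sum this).trans ?_
    rw [Finset.sum_ite_eq]
    split_ifs <;> simp
  calc _ ≤ ∑ j ∈ range J, (p:ℤ) := Finset.sum_le_sum hb
    _ = _ := by simp

theorem jac_eq_qc (p : ℕ) [Fact p.Prime] (n : ℕ) : jacobiSym (n:ℤ) p = quadraticChar (ZMod p) (n : ZMod p) := by
  rw [← jacobiSym.legendreSym.to_jacobiSym]; simp [legendreSym]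

theorem S_shift (p : ℕ) [Fact p.Prime] (i H : ℕ) :
    S (H+i) p - S i p = ∑ j ∈ range H, quadraticChar (ZMod p) (((i+1:ℕ):ZMod p) + (j:ZMod p)) := by
  induction H with
  | zero => simp
  | succ H ih =>
    rw [Finset.sum_range_succ, ← ih]
    have : S (H+1+i) p = S (H+i) p + jacobiSym ((H+i+1:ℕ):ℤ) p := by
      unfold S
      rw [show H+1+i = (H+i)+1 by ring, Finset.sum_Icc_succ_top (by omega)]
    rw [this, jac_eq_qc, ← Nat.cast_add, show H+i+1 = i+1+H by ring]
    ring

theorem double_step (p : ℕ) [Fact p.Prime] (hp2 : p ≠ 2) (H : ℕ) (hH : H ≤ p) :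
    ((∑ i ∈ range H, (S (H+i) p - S i p) : ℤ):ℝ) ≤ H * √(p:ℝ) := by
  have h1 : (∑ i ∈ range H, (S (H+i) p - S i p))^2 ≤ (H:ℤ) * (H * p) := by
    refine (sq_sum_le_card_mul_sum_sq).trans ?_
    rw [Finset.card_range]
    refine mul_le_mul_of_nonneg_left ?_ (by positivity)
    refine le_trans ?_ (qc_sq_sum p hp2 H hH)
    simp only [S_shift]
    have hinj : Set.InjOn (fun i : ℕ => ((i+1:ℕ):ZMod p)) (range H : Set ℕ) := by
      intro a ha b hb hab
      simp only [Nat.cast_add, Nat.cast_one, add_left_inj] at hab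
      rw [ZMod.natCast_eq_natCast_iff'] at hab
      simp only [Finset.coe_range, Set.mem_Iio] at ha hb
      rwa [Nat.mod_eq_of_lt (by omega), Nat.mod_eq_of_lt (by omega)] at hab
    rw [← Finset.sum_image (f := fun c : ZMod p => (∑ j ∈ range H, quadraticChar (ZMod p) (c + (j:ZMod p)))^2) hinj]
    exact Finset.sum_le_univ_sum_of_nonneg (fun c => sq_nonneg _)
  have h2 : (((∑ i ∈ range H, (S (H+i) p - S i p) : ℤ):ℝ))^2 ≤ (H * √(p:ℝ))^2 := by
    rw [mul_pow, Real.sq_sqrt (by positivity)]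
    have : (((∑ i ∈ range H, (S (H+i) p - S i p))^2 : ℤ):ℝ) ≤ (((H:ℤ) * (H * p) : ℤ) : ℝ) := by exact_mod_cast h1
    push_cast at this ⊢
    linarith
  exact abs_le_of_sq_le_sq' h2 (by positivity) |>.2

theorem T_bound (p : ℕ) [Fact p.Prime] (hp2 : p ≠ 2) (j : ℕ) (hj : 2^j ≤ p) :
    ((∑ i ∈ range (2^j), S i p : ℤ):ℝ) ≤ 2^j * j * √(p:ℝ) / 2 := by
  induction j with
  | zero => simp [S]
  | succ j ih =>
    have hj' : 2^j ≤ p := le_trans (Nat.pow_le_pow_right (by norm_num) (by omega)) hj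
    have h1 := ih hj'
    have h2 := double_step p hp2 (2^j) hj'
    have e : ∑ i ∈ range (2^(j+1)), S i p = 2 * ∑ i ∈ range (2^j), S i p + ∑ i ∈ range (2^j), (S (2^j+i) p - S i p) := by
      rw [pow_succ, mul_two, Finset.sum_range_add, Finset.sum_sub_distrib]; ring
    rw [e]
    push_cast at h1 h2 ⊢
    rw [pow_succ]
    linarith

theorem S_pred (p : ℕ) [Fact p.Prime] (hp2 : p ≠ 2) : S (p-1) p = 0 := by
  have hch : ringChar (ZMod p) ≠ 2 := by
    rw [ZMod.ringChar_zmod_n]; exact hp2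
  have h0 := quadraticChar_sum_zero hch
  have hp := (Fact.out : p.Prime).pos
  have e : S (p-1) p = ∑ n ∈ range p, quadraticChar (ZMod p) (n:ZMod p) := by
    unfold S
    simp only [jac_eq_qc]
    rw [Finset.range_eq_Ico, Finset.sum_eq_sum_Ico_succ_bot hp]
    rw [Nat.cast_zero, MulChar.map_zero, zero_add, zero_add]
    apply Finset.sum_congr _ (fun _ _ => rfl)
    ext n; simp; omega
  rw [e, ← h0]
  refine Finset.sum_bij (fun n _ => (n:ZMod p)) (by simp) ?_ ?_ (by simp)
  · intro a ha b hb hab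
    rw [ZMod.natCast_eq_natCast_iff'] at hab
    simp only [Finset.mem_range] at ha hb
    rwa [Nat.mod_eq_of_lt (by omega), Nat.mod_eq_of_lt (by omega)] at hab
  · intro b _
    exact ⟨b.val, by simp [ZMod.val_lt], by simp⟩

theorem fpt_lt (ε : ℝ) (hε : 0 < ε) (p : ℕ) (hp : p.Prime) (hp2 : p ≠ 2) : fpt ε p < p := by
  haveI := Fact.mk hp
  have h3 : 2 < p := lt_of_le_of_ne hp.two_le (Ne.symm hp2)
  have : fpt ε p ≤ p - 1 := by
    refine Nat.sInf_le ⟨by omega, ?_⟩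
    rw [S_pred p hp2]
    have : (0:ℝ) < ((p-1:ℕ):ℝ) := by exact_mod_cast (by omega)
    simpa using mul_pos hε this
  omega

theorem S_ge_of_lt (ε : ℝ) (p m : ℕ) (hm : 1 ≤ m) (h : m < fpt ε p) : ε * m ≤ (S m p : ℝ) := by
  have := Nat.notMem_of_lt_sInf h
  by_contra hc
  exact this ⟨hm, not_le.mp hc⟩

theorem fpt_le (ε : ℝ) (hε : 0 < ε) (p : ℕ) (hp : p.Prime) (hp2 : p ≠ 2) :
    (fpt ε p : ℝ) ≤ 2 + 2 * (Nat.log 2 p) * √(p:ℝ) / ε := by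
  haveI := Fact.mk hp
  have hlt := fpt_lt ε hε p hp hp2
  rcases Nat.eq_zero_or_pos (fpt ε p) with h0 | hpos
  · rw [h0]; simp; positivity
  set F := fpt ε p with hF
  set j := Nat.log 2 F with hjd
  have hj1 : 2^j ≤ F := Nat.pow_log_le_self 2 hpos.ne'
  have hj2 : F < 2^(j+1) := Nat.lt_pow_succ_log_self (by norm_num) F
  have hjp : j ≤ Nat.log 2 p := Nat.log_mono_right hlt.le
  have hT := T_bound p hp2 j (by omega)
  have hlow : ε * (2^j * (2^j - 1) / 2) ≤ ((∑ i ∈ range (2^j), S i p : ℤ):ℝ) := by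
    push_cast
    have : ∀ i ∈ range (2^j), ε * (i:ℝ) ≤ (S i p : ℝ) := by
      intro i hi
      rcases Nat.eq_zero_or_pos i with h | h
      · subst h; simp [S]
      · have := Finset.mem_range.mp hi
        exact S_ge_of_lt ε p i h (by omega)
    refine le_trans (le_of_eq ?_) (Finset.sum_le_sum this)
    rw [← Finset.mul_sum]
    congr 1
    have := Finset.sum_range_id_mul_two (2^j)
    have h2 : ((∑ i ∈ range (2^j), i : ℕ):ℝ) * 2 = 2^j * (2^j - 1) := by
      have h3 : (1:ℕ) ≤ 2^j := Nat.one_le_two_pow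
      have := congrArg (Nat.cast (R := ℝ)) this
      push_cast [Nat.cast_sub h3] at this ⊢
      exact this
    push_cast at h2
    linarith
  have h5 : ε * (2^j - 1) ≤ j * √(p:ℝ) := by
    have hpw : (0:ℝ) < 2^j := by positivity
    have := hlow.trans hT
    have h6 : (2^j:ℝ) * (ε * (2^j - 1)) ≤ 2^j * (j * √(p:ℝ)) := by nlinarith
    exact le_of_mul_le_mul_left h6 hpw
  have h7 : (2:ℝ)^j - 1 ≤ (Nat.log 2 p) * √(p:ℝ) / ε := by
    rw [le_div_iff₀ hε]
    have : (j:ℝ) * √(p:ℝ) ≤ (Nat.log 2 p) * √(p:ℝ) := by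
      gcongr
    linarith
  have h8 : (F:ℝ) ≤ 2 * 2^j := by
    have : F ≤ 2 * 2^j := by rw [pow_succ] at hj2; omega
    exact_mod_cast this
  have h9 : 2 * ((Nat.log 2 p) * √(p:ℝ) / ε) = 2 * (Nat.log 2 p) * √(p:ℝ) / ε := by ring
  linarith

theorem jac_prod (p : ℕ) {ι : Type} (s : Finset ι) (t : ι → ℕ) :
    ∏ i ∈ s, jacobiSym (t i : ℤ) p = jacobiSym ((∏ i ∈ s, t i : ℕ) : ℤ) p := by
  classical
  induction s using Finset.induction_on with
  | empty => simp [jacobiSym.one_left]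
  | insert a s ha ih =>
    rw [Finset.prod_insert ha, Finset.prod_insert ha, ih, Nat.cast_mul, jacobiSym.mul_left]

theorem S_pow (p m k : ℕ) : S m p ^ k =
    ∑ t ∈ Fintype.piFinset (fun _ : Fin k => Icc 1 m), jacobiSym ((∏ i, t i : ℕ):ℤ) p := by
  have := Finset.prod_univ_sum (fun _ : Fin k => Icc 1 m) (fun _ (n:ℕ) => jacobiSym (n:ℤ) p)
  simp only [Finset.prod_const, Finset.card_univ, Fintype.card_fin] at this
  unfold S
  rw [this]
  exact Finset.sum_congr rfl fun t _ => jac_prod p _ _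

theorem sum_F_sq (E : Finset ℕ) (X A : ℕ) (hE : ∀ p ∈ E, p.Prime ∧ p ≠ 2 ∧ p ≤ X) :
    ∑ n ∈ range A, (∑ p ∈ E, jacobiSym (n:ℤ) p)^2 ≤ (E.card:ℤ) * A + (E.card:ℤ)^2 * X^2 := by
  have e : ∑ n ∈ range A, (∑ p ∈ E, jacobiSym (n:ℤ) p)^2 =
      ∑ p ∈ E, ∑ q ∈ E, ∑ n ∈ range A, jacobiSym (n:ℤ) p * jacobiSym (n:ℤ) q := by
    simp only [sq, Finset.sum_mul_sum]
    rw [Finset.sum_comm]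
    refine Finset.sum_congr rfl fun j _ => ?_
    rw [Finset.sum_comm]
  rw [e]
  have hb : ∀ p ∈ E, ∑ q ∈ E, ∑ n ∈ range A, jacobiSym (n:ℤ) p * jacobiSym (n:ℤ) q
      ≤ (A:ℤ) + (E.card:ℤ) * X^2 := by
    intro p hp
    have h1 : ∀ q ∈ E, ∑ n ∈ range A, jacobiSym (n:ℤ) p * jacobiSym (n:ℤ) q
        ≤ (if p = q then (A:ℤ) else 0) + (X:ℤ)^2 := by
      intro q hq
      obtain ⟨p1, p2, p3⟩ := hE p hp
      obtain ⟨q1, q2, q3⟩ := hE q hq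
      split_ifs with h
      · subst h
        have : ∑ n ∈ range A, jacobiSym (n:ℤ) p * jacobiSym (n:ℤ) p ≤ ∑ n ∈ range A, (1:ℤ) := by
          refine Finset.sum_le_sum fun n _ => ?_
          have := jac_abs_le (n:ℤ) p
          rw [abs_le] at this
          nlinarith
        simp only [Finset.sum_const, Finset.card_range, nsmul_eq_mul, mul_one] at this
        have := sq_nonneg (X:ℤ)
        linarith
      · have h2 := (le_abs_self _).trans (sum_two_primes p q p1 q1 p2 h A)
        have h3 : ((p*q:ℕ):ℤ) ≤ (X:ℤ)^2 := by
          have : p * q ≤ X * X := Nat.mul_le_mul p3 q3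
          rw [sq]; exact_mod_cast this
        linarith
    refine (Finset.sum_le_sum h1).trans ?_
    rw [Finset.sum_add_distrib, Finset.sum_ite_eq, if_pos hp, Finset.sum_const, nsmul_eq_mul]
  refine (Finset.sum_le_sum hb).trans ?_
  rw [Finset.sum_const, nsmul_eq_mul]
  apply le_of_eq; ring

theorem fiber_card (m k n : ℕ) :
    ((Fintype.piFinset (fun _ : Fin k => Icc 1 m)).filter (fun t => ∏ i, t i = n)).card
      ≤ n.divisors.card ^ k ∨ n = 0 := by
  by_cases hn : n = 0
  · exact Or.inr hn
  left
  have : ((Fintype.piFinset (fun _ : Fin k => Icc 1 m)).filter (fun t => ∏ i, t i = n))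
     ⊆ Fintype.piFinset (fun _ : Fin k => n.divisors) := by
    intro t ht
    rw [Finset.mem_filter] at ht
    rw [Fintype.mem_piFinset]
    intro i
    rw [Nat.mem_divisors]
    refine ⟨?_, hn⟩
    rw [← ht.2]
    exact Finset.dvd_prod_of_mem _ (Finset.mem_univ i)
  refine (Finset.card_le_card this).trans ?_
  rw [Fintype.card_piFinset]
  simp

theorem large_core (ε : ℝ) (hε : 0 < ε) (m k X : ℕ) (D : ℝ) (hm : 1 ≤ m) (hD0 : 0 ≤ D)
    (hD : ∀ n : ℕ, n ≠ 0 → n ≤ m^k → (n.divisors.card:ℝ)^k ≤ D)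
    (hX : D * (X:ℝ)^2 ≤ ε^(2*k) * (m:ℝ)^k / 2) (E : Finset ℕ)
    (hE : ∀ p ∈ E, p.Prime ∧ p ≠ 2 ∧ p ≤ X) (hES : ∀ p ∈ E, ε * m ≤ (S m p:ℝ)) :
    (E.card:ℝ) * ε^(2*k) ≤ 4 * D := by
  classical
  set P := Fintype.piFinset (fun _ : Fin k => Icc 1 m) with hP
  let F : ℕ → ℤ := fun n => ∑ p ∈ E, jacobiSym (n:ℤ) p
  have hmk : (1:ℝ) ≤ (m:ℝ)^k := one_le_pow₀ (by exact_mod_cast hm)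
  -- lower
  have h1 : (E.card:ℝ) * (ε*m)^k ≤ ((∑ t ∈ P, F (∏ i, t i) : ℤ):ℝ) := by
    have e : ∑ t ∈ P, F (∏ i, t i) = ∑ p ∈ E, S m p ^ k := by
      simp only [F]
      rw [Finset.sum_comm]
      exact Finset.sum_congr rfl fun p _ => (S_pow p m k).symm
    rw [e]; push_cast
    rw [← nsmul_eq_mul, ← Finset.sum_const]
    exact Finset.sum_le_sum fun p hp => pow_le_pow_left₀ (by positivity) (hES p hp) k
  have hPc : (P.card:ℝ) = (m:ℝ)^k := by
    rw [hP, Fintype.card_piFinset]; simp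
  have h2 : ((∑ t ∈ P, F (∏ i, t i) : ℤ):ℝ)^2 ≤ (m:ℝ)^k * ∑ t ∈ P, ((F (∏ i, t i) : ℤ):ℝ)^2 := by
    rw [← hPc]; push_cast
    exact sq_sum_le_card_mul_sum_sq
  have h3 : ∑ t ∈ P, ((F (∏ i, t i) : ℤ):ℝ)^2 ≤ D * ∑ n ∈ range (m^k+1), ((F n : ℤ):ℝ)^2 := by
    have hmaps : ∀ t ∈ P, (∏ i, t i) ∈ range (m^k+1) := by
      intro t ht
      rw [hP, Fintype.mem_piFinset] at ht
      rw [Finset.mem_range, Nat.lt_succ_iff]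
      calc ∏ i, t i ≤ ∏ i : Fin k, m := Finset.prod_le_prod' fun i _ => (Finset.mem_Icc.mp (ht i)).2
        _ = m^k := by simp
    rw [← Finset.sum_fiberwise_of_maps_to hmaps, Finset.mul_sum]
    refine Finset.sum_le_sum fun n hn => ?_
    have e : ∑ t ∈ P with ∏ i, t i = n, ((F (∏ i, t i) : ℤ):ℝ)^2
       = ((P.filter (fun t => ∏ i, t i = n)).card:ℝ) * ((F n:ℤ):ℝ)^2 := by
      rw [← nsmul_eq_mul, ← Finset.sum_const]
      refine Finset.sum_congr rfl fun t ht => ?_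
      rw [(Finset.mem_filter.mp ht).2]
    rw [e]
    refine mul_le_mul_of_nonneg_right ?_ (sq_nonneg _)
    by_cases hn0 : n = 0
    · have : P.filter (fun t => ∏ i, t i = n) = ∅ := by
        rw [Finset.filter_eq_empty_iff]
        intro t ht h0
        rw [hn0, Finset.prod_eq_zero_iff] at h0
        obtain ⟨i, _, hi⟩ := h0
        rw [hP, Fintype.mem_piFinset] at ht
        have := (Finset.mem_Icc.mp (ht i)).1
        omega
      rw [this]; simpa using hD0
    · rcases fiber_card m k n with h | h
      · refine le_trans ?_ (hD n hn0 (Nat.lt_succ_iff.mp (Finset.mem_range.mp hn)))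
        exact_mod_cast h
      · exact absurd h hn0
  have h4 : ∑ n ∈ range (m^k+1), ((F n : ℤ):ℝ)^2 ≤ (E.card:ℝ) * ((m:ℝ)^k+1) + (E.card:ℝ)^2 * (X:ℝ)^2 := by
    have := sum_F_sq E X (m^k+1) hE
    have h := (Int.cast_le (R := ℝ)).mpr this
    push_cast at h
    simp only [F]
    push_cast
    exact h
  set e := (E.card:ℝ) with he
  have he0 : 0 ≤ e := by positivity
  rcases eq_or_lt_of_le he0 with hz | hpos
  · rw [← hz]; simpa using hD0
  set M := (m:ℝ)^k with hM
  have h5 : (e * (ε*m)^k)^2 ≤ M * (D * (e * (M+1) + e^2 * (X:ℝ)^2)) := by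
    calc (e * (ε*m)^k)^2 ≤ ((∑ t ∈ P, F (∏ i, t i) : ℤ):ℝ)^2 := pow_le_pow_left₀ (by positivity) h1 2
      _ ≤ _ := h2
      _ ≤ _ := by
        refine mul_le_mul_of_nonneg_left ?_ (by positivity)
        exact h3.trans (mul_le_mul_of_nonneg_left h4 hD0)
  have e1 : (e * (ε*m)^k)^2 = e * M * (e * ε^(2*k) * M) := by
    rw [mul_pow, mul_pow, hM, pow_mul']; ring
  have e2 : M * (D * (e * (M+1) + e^2 * (X:ℝ)^2)) = e * M * (D * (M+1) + e * (D * (X:ℝ)^2)) := by ring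
  rw [e1, e2] at h5
  have h6 := le_of_mul_le_mul_left h5 (by positivity)
  have h7 : e * (D * (X:ℝ)^2) ≤ e * (ε^(2*k) * M / 2) := mul_le_mul_of_nonneg_left hX he0
  have h8 : D * (M+1) ≤ D * (2*M) := mul_le_mul_of_nonneg_left (by linarith) hD0
  have h9 : M * (e * ε^(2*k)) ≤ M * (4 * D) := by nlinarith
  exact le_of_mul_le_mul_left h9 (by positivity)

theorem div_pow_aux (C : ℝ) (hC : 0 < C) (hd : ∀ n : ℕ, n ≠ 0 → (n.divisors.card:ℝ) ≤ C*(n:ℝ)^(1/1800:ℝ))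
    (R n k : ℕ) (hk : k = 60) (hn : n ≠ 0) (hle : n ≤ R^k) :
    (n.divisors.card:ℝ)^k ≤ C^k * (R:ℝ)^2 := by
  have h1 := hd n hn
  have hkr : (k:ℝ) = 60 := by rw [hk]; norm_num
  have hc : (n:ℝ) ≤ (R:ℝ)^k := by exact_mod_cast hle
  have h2 : (n:ℝ)^(1/1800:ℝ) ≤ (R:ℝ)^(1/30:ℝ) := by
    calc (n:ℝ)^(1/1800:ℝ) ≤ ((R:ℝ)^k)^(1/1800:ℝ) :=
          Real.rpow_le_rpow (by positivity) hc (by norm_num)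
      _ = (R:ℝ)^(1/30:ℝ) := by
          rw [← Real.rpow_natCast, ← Real.rpow_mul (by positivity), hkr]; norm_num
  calc (n.divisors.card:ℝ)^k ≤ (C * (R:ℝ)^(1/30:ℝ))^k :=
        pow_le_pow_left₀ (by positivity) (h1.trans (mul_le_mul_of_nonneg_left h2 hC.le)) k
    _ = C^k * (R:ℝ)^2 := by
        rw [mul_pow]
        congr 1
        rw [← Real.rpow_natCast, ← Real.rpow_mul (by positivity), ← Real.rpow_natCast, hkr]; norm_num

theorem size_aux (R X K e : ℝ) (hR1 : 1 ≤ R) (hX0 : 0 ≤ X) (hX : X ≤ (R+1)^20) (hK : 0 ≤ K) (he : 0 ≤ e)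
    (h : 2 * K * 2^40 ≤ e * R) (k : ℕ) (hk : k = 60) : K * R^2 * X^2 ≤ e * R^k / 2 := by
  have hX' : X ≤ (2*R)^20 := hX.trans (pow_le_pow_left₀ (by positivity) (by linarith) 20)
  have hRp : R ≤ R^18 := le_self_pow₀ hR1 (by norm_num)
  have h2 : X^2 ≤ ((2*R)^20)^2 := pow_le_pow_left₀ hX0 hX' 2
  have h3 : 2 * K * 2^40 ≤ e * R^18 := h.trans (mul_le_mul_of_nonneg_left hRp he)
  have h4 : (2 * K * 2^40) * R^42 ≤ (e * R^18) * R^42 := mul_le_mul_of_nonneg_right h3 (by positivity)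
  have h5 : K * R^2 * X^2 ≤ K * R^2 * ((2*R)^20)^2 := mul_le_mul_of_nonneg_left h2 (by positivity)
  have e1 : K * R^2 * ((2*R)^20)^2 = (2 * K * 2^40) * R^42 / 2 := by ring
  have e2 : (e * R^18) * R^42 = e * R^k := by rw [hk, mul_assoc, ← pow_add]
  linarith

theorem large_bound (ε : ℝ) (hε : 0 < ε) : ∃ C : ℝ, 0 < C ∧ ∃ R0 : ℕ, ∀ R X : ℕ, R0 ≤ R → 1 ≤ R →
    (X:ℝ) ≤ ((R:ℝ)+1)^20 →
    (((range (X+1)).filter (fun p => (p.Prime ∧ p ≠ 2) ∧ ε * R ≤ (S R p : ℝ))).card:ℝ) ≤ C * (R:ℝ)^2 := by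
  obtain ⟨C, hC, hd⟩ := divisor_bound (1/1800) (by norm_num)
  obtain ⟨k, hk⟩ : ∃ k : ℕ, k = 60 := ⟨60, rfl⟩
  have hε' : 0 < ε^(2*k) := by positivity
  obtain ⟨R0, hR0⟩ := exists_nat_ge (2 * C^k * 2^40 / ε^(2*k))
  refine ⟨4 * C^k / ε^(2*k), by positivity, R0, fun R X hR hR1 hX => ?_⟩
  have hR1' : (1:ℝ) ≤ R := by exact_mod_cast hR1
  have key := large_core ε hε R k X (C^k * (R:ℝ)^2) hR1 (by positivity) ?_ ?_
    ((range (X+1)).filter (fun p => (p.Prime ∧ p ≠ 2) ∧ ε * R ≤ (S R p : ℝ))) ?_ ?_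
  · rw [div_mul_eq_mul_div, le_div_iff₀ hε']
    linarith
  · intro n hn hle
    exact div_pow_aux C hC hd R n k hk hn hle
  · refine size_aux R X (C^k) (ε^(2*k)) hR1' (by positivity) hX (by positivity) hε'.le ?_ k hk
    have : 2 * C^k * 2^40 / ε^(2*k) ≤ R := hR0.trans (by exact_mod_cast hR)
    rw [div_le_iff₀ hε'] at this
    linarith
  · intro p hp
    simp only [Finset.mem_filter, Finset.mem_range] at hp
    exact ⟨hp.2.1.1, hp.2.1.2, by omega⟩
  · intro p hp
    exact (Finset.mem_filter.mp hp).2.2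

theorem piOdd_ge : ∃ X0 : ℕ, ∀ x : ℝ, X0 ≤ ⌊x⌋₊ →
    (1/4:ℝ) * (⌊x⌋₊:ℝ) / Real.log (⌊x⌋₊:ℝ) ≤ (piOdd x : ℝ) := by
  have ht : ∀ᶠ n : ℕ in atTop, Real.log (n:ℝ) ≤ 0.1 * (n:ℝ) := by
    have := (Real.isLittleO_log_id_atTop).bound (show (0:ℝ) < 0.1 by norm_num)
    have h2 := tendsto_natCast_atTop_atTop (R := ℝ) |>.eventually this
    filter_upwards [h2] with n hn
    simp only [Real.norm_eq_abs, id, Nat.abs_cast] at hn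
    exact (le_abs_self _).trans hn
  obtain ⟨N, hN⟩ := eventually_atTop.mp ht
  refine ⟨max N 20, fun x hx => ?_⟩
  set X := ⌊x⌋₊ with hXd
  have hX1 : N ≤ X := (le_max_left _ _).trans hx
  have hX2 : 20 ≤ X := (le_max_right _ _).trans hx
  have hX2' : (20:ℝ) ≤ X := by exact_mod_cast hX2
  have h1 := Chebyshev.pi_ge X
  have hlog : 0 < Real.log (X:ℝ) := Real.log_pos (by linarith)
  have hcard : (Nat.primeCounting X : ℝ) = piOdd x + 1 := by
    have : Nat.primeCounting X = piOdd x + 1 := by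
      rw [Nat.primeCounting, Nat.primeCounting', Nat.count_eq_card_filter_range, piOdd, oddPrimesUpTo, ← hXd]
      have h2 : (range (X+1)).filter Nat.Prime = insert 2 ((range (X+1)).filter (fun p => p.Prime ∧ p ≠ 2)) := by
        ext p
        simp only [Finset.mem_filter, Finset.mem_insert, Finset.mem_range]
        constructor
        · rintro ⟨a, b⟩
          by_cases h : p = 2
          · exact Or.inl h
          · exact Or.inr ⟨a, b, h⟩
        · rintro (h | h)
          · subst h; exact ⟨by omega, Nat.prime_two⟩
          · exact ⟨h.1, h.2.1⟩
      rw [h2, Finset.card_insert_of_notMem (by simp)]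
    exact_mod_cast this
  rw [hcard, div_le_iff₀ hlog] at h1
  rw [div_le_iff₀ hlog]
  have h3 := hN X hX1
  have h4 : Real.log ((X:ℝ)+1) ≤ Real.log X + 1/X := by
    have : (X:ℝ)+1 = X * (1 + 1/X) := by field_simp
    rw [this, Real.log_mul (by positivity) (by positivity)]
    have := Real.log_le_sub_one_of_pos (show (0:ℝ) < 1 + 1/X by positivity)
    linarith
  have h5 : (1:ℝ)/X ≤ 1 := by rw [div_le_one (by linarith)]; linarith
  have := Real.log_two_gt_d9
  nlinarith

theorem sum_fpt_upper (O : Finset ℕ) (f : ℕ → ℕ) (R : ℕ) :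
    ∑ p ∈ O, (f p : ℝ) ≤ ∑ m ∈ range R, ((O.filter (fun p => m < f p)).card : ℝ)
      + ∑ p ∈ O.filter (fun p => R < f p), (f p : ℝ) := by
  have e : ∑ m ∈ range R, ((O.filter (fun p => m < f p)).card : ℝ)
      = ∑ p ∈ O, ∑ m ∈ range R, if m < f p then (1:ℝ) else 0 := by
    rw [Finset.sum_comm]
    refine Finset.sum_congr rfl fun m _ => ?_
    rw [Finset.card_filter]; push_cast; rfl
  rw [e, Finset.sum_filter, ← Finset.sum_add_distrib]
  refine Finset.sum_le_sum fun p _ => ?_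
  have hnn : (0:ℝ) ≤ ∑ m ∈ range R, if m < f p then (1:ℝ) else 0 :=
    Finset.sum_nonneg fun m _ => by split_ifs <;> norm_num
  split_ifs with h
  · linarith
  · rw [add_zero, ← Finset.sum_filter, Finset.sum_const, nsmul_eq_mul, mul_one]
    have : (range R).filter (fun m => m < f p) = range (f p) := by
      ext m; simp; omega
    rw [this, Finset.card_range]

theorem sum_fpt_lower (O : Finset ℕ) (f : ℕ → ℕ) (M : ℕ) :
    ∑ m ∈ range M, ((O.filter (fun p => m < f p)).card : ℝ) ≤ ∑ p ∈ O, (f p : ℝ) := by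
  have e : ∑ m ∈ range M, ((O.filter (fun p => m < f p)).card : ℝ)
      = ∑ p ∈ O, ∑ m ∈ range M, if m < f p then (1:ℝ) else 0 := by
    rw [Finset.sum_comm]
    refine Finset.sum_congr rfl fun m _ => ?_
    rw [Finset.card_filter]; push_cast; rfl
  rw [e]
  refine Finset.sum_le_sum fun p _ => ?_
  rw [← Finset.sum_filter, Finset.sum_const, nsmul_eq_mul, mul_one]
  have : ((range M).filter (fun m => m < f p)).card ≤ f p := by
    calc _ ≤ (range (f p)).card := Finset.card_le_card (by intro m; simp)
      _ = f p := Finset.card_range _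
  exact_mod_cast this

theorem medium' (ε : ℝ) (hε : 0 < ε) : ∃ K : ℝ, 0 < K ∧ ∀ m R X : ℕ, 1 ≤ m → m ≤ R →
    (((range (X+1)).filter (fun p => (p.Prime ∧ p≠2) ∧ ε*m ≤ (S m p:ℝ))).card:ℝ)
      ≤ K * ((m:ℝ)^(-(3/2):ℝ) * (X / Real.log (R+1)) + (R:ℝ)^8) := by
  obtain ⟨C, hC, h⟩ := medium_bound
  refine ⟨1 + 2*C/ε^4 + 4/ε^4, by positivity, fun m R X hm hmR => ?_⟩
  have h1 := h ε hε R m X (hm.trans hmR) hm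
  have hm' : (1:ℝ) ≤ m := by exact_mod_cast hm
  have hR' : (1:ℝ) ≤ R := by exact_mod_cast hm.trans hmR
  have hmR' : (m:ℝ) ≤ R := by exact_mod_cast hmR
  have hpos : 0 < (ε*m)^4 := by positivity
  have hlog : 0 < Real.log ((R:ℝ)+1) := Real.log_pos (by linarith)
  rw [← le_div_iff₀ hpos] at h1
  refine h1.trans ?_
  have e52 : (m:ℝ)^(5/2:ℝ) = (m:ℝ)^(-(3/2):ℝ) * (m:ℝ)^4 := by
    rw [← Real.rpow_natCast, ← Real.rpow_add (by positivity)]; norm_num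
  set w := (m:ℝ)^(-(3/2):ℝ) with hw
  have hw0 : 0 ≤ w := by positivity
  have hw1 : w ≤ 1 := Real.rpow_le_one_of_one_le_of_nonpos hm' (by norm_num)
  rw [e52]
  set Q := (X:ℝ) / Real.log ((R:ℝ)+1) with hQ
  have hQ0 : 0 ≤ Q := by positivity
  have e : (R*(ε*m)^4 + (C*(w*(m:ℝ)^4)*(X*(2/Real.log (R+1)) + (R:ℝ)^4) + (m:ℝ)^4*((R:ℝ)^4*(4*(m:ℝ)^4))))/(ε*m)^4
     = R + (2*C/ε^4) * (w * Q) + (C/ε^4) * (w * (R:ℝ)^4) + (4/ε^4) * ((R:ℝ)^4 * (m:ℝ)^4) := by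
    rw [hQ]; field_simp
    ring
  rw [e]
  have b1 : (R:ℝ) ≤ (R:ℝ)^8 := le_self_pow₀ hR' (by norm_num)
  have b2 : w * (R:ℝ)^4 ≤ 1 * (R:ℝ)^8 := mul_le_mul hw1 (pow_le_pow_right₀ hR' (by norm_num)) (by positivity) (by norm_num)
  have b3 : (R:ℝ)^4 * (m:ℝ)^4 ≤ (R:ℝ)^8 := by
    calc (R:ℝ)^4 * (m:ℝ)^4 ≤ (R:ℝ)^4 * (R:ℝ)^4 := by gcongr
      _ = _ := by ring
  have c1 : (C/ε^4) * (w * (R:ℝ)^4) ≤ (C/ε^4) * (R:ℝ)^8 := mul_le_mul_of_nonneg_left (by linarith) (by positivity)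
  have c2 := mul_le_mul_of_nonneg_left b3 (show 0 ≤ 4/ε^4 by positivity)
  have p1 : 0 ≤ w * Q := by positivity
  have p2 : 0 ≤ 4/ε^4 * (w*Q) := by positivity
  have p3 : 0 ≤ (C/ε^4) * (R:ℝ)^8 := by positivity
  have : (2*C/ε^4) * (R:ℝ)^8 = 2 * ((C/ε^4) * (R:ℝ)^8) := by ring
  nlinarith

theorem natlog_le (X : ℕ) (hX : 1 ≤ X) : (Nat.log 2 X : ℝ) ≤ 2 * Real.log X := by
  have h : 2 ^ Nat.log 2 X ≤ X := Nat.pow_log_le_self 2 (by omega)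
  have h2 : ((2:ℝ)) ^ Nat.log 2 X ≤ X := by exact_mod_cast h
  have h3 := Real.log_le_log (by positivity) h2
  rw [Real.log_pow] at h3
  have := Real.log_two_gt_d9
  have : (0:ℝ) ≤ Nat.log 2 X := by positivity
  nlinarith

def Btail (M : ℕ) : ℝ := ∑' i : ℕ, (((i + M : ℕ)):ℝ)^(-(3/2):ℝ)

theorem Btail_tendsto : Tendsto Btail atTop (nhds 0) :=
  tendsto_sum_nat_add (fun n : ℕ => (n:ℝ)^(-(3/2):ℝ))

theorem sum_le_Btail (M R : ℕ) : ∑ m ∈ Ico M R, (m:ℝ)^(-(3/2):ℝ) ≤ Btail M := by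
  rw [Finset.sum_Ico_eq_sum_range]
  have hs : Summable (fun n : ℕ => (n:ℝ)^(-(3/2):ℝ)) := Real.summable_nat_rpow.mpr (by norm_num)
  have hs2 := (summable_nat_add_iff M).mpr hs
  refine le_trans (le_of_eq ?_) (hs2.sum_le_tsum (range (R-M)) (fun i _ => by positivity))
  refine Finset.sum_congr rfl fun i _ => ?_
  rw [add_comm]

theorem core_upper (ε : ℝ) (hε : 0 < ε) : ∃ K : ℝ, 0 < K ∧ ∃ X0 : ℕ, ∀ x : ℝ, X0 ≤ ⌊x⌋₊ → ∀ M : ℕ, 1 ≤ M →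
    0 < (piOdd x : ℝ) ∧
    (∑ p ∈ oddPrimesUpTo x, (fpt ε p:ℝ))/(piOdd x:ℝ) ≤ ∑ m ∈ range M, aCoef ε m x + K * Btail M
      + K * (Real.log (⌊x⌋₊:ℝ) / (⌊x⌋₊:ℝ)^(1/5:ℝ))^2 := by
  obtain ⟨X1, hpi⟩ := piOdd_ge
  obtain ⟨K1, hK1, hmed⟩ := medium' ε hε
  obtain ⟨K2, hK2, R0, hlarge⟩ := large_bound ε hε
  refine ⟨80*K1 + 4*(K1 + K2*(2+4/ε)), by positivity, max X1 ((R0+2)^20), fun x hx M hM => ?_⟩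
  set X := ⌊x⌋₊ with hXd
  have hX1 : X1 ≤ X := (le_max_left _ _).trans hx
  have hX2 : (R0+2)^20 ≤ X := (le_max_right _ _).trans hx
  have hX2' : ((R0:ℝ)+2)^20 ≤ (X:ℝ) := by
    have := (Nat.cast_le (α := ℝ)).mpr hX2
    push_cast at this; exact this
  set y := (X:ℝ)^(1/20:ℝ) with hy
  have hy0 : 0 ≤ y := by positivity
  have hyX : y^20 = X := by
    rw [hy, ← Real.rpow_natCast, ← Real.rpow_mul (by positivity)]; norm_num
  have hyR0 : (R0:ℝ)+2 ≤ y := by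
    rw [← hyX] at hX2'
    exact le_of_pow_le_pow_left₀ (by norm_num) hy0 hX2'
  have hy2 : 2 ≤ y := by have : (0:ℝ) ≤ R0 := by positivity
                         linarith
  set R := ⌊y⌋₊ with hR
  have hRy : (R:ℝ) ≤ y := Nat.floor_le hy0
  have hyR : y < (R:ℝ)+1 := Nat.lt_floor_add_one y
  have hRR0 : R0 ≤ R := by
    rw [hR]; exact Nat.le_floor (by linarith)
  have hR1 : 1 ≤ R := Nat.le_floor (by push_cast; linarith)
  have hR1' : (1:ℝ) ≤ R := by exact_mod_cast hR1
  have hXR : (X:ℝ) ≤ ((R:ℝ)+1)^20 := by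
    rw [← hyX]; exact pow_le_pow_left₀ hy0 hyR.le 20
  set L := Real.log (X:ℝ) with hL
  have hLy : L = 20 * Real.log y := by rw [hL, ← hyX, Real.log_pow]; norm_num
  have hLR : L ≤ 20 * Real.log ((R:ℝ)+1) := by
    rw [hLy]
    have := Real.log_le_log (by linarith) hyR.le
    linarith
  have hL1 : 1 ≤ L := by
    have := Real.log_le_log (by norm_num) hy2
    have := Real.log_two_gt_d9
    linarith
  have hXpos : 0 < (X:ℝ) := by rw [← hyX]; positivity
  have hp := hpi x hX1
  rw [← hXd] at hp
  have hp0 : 0 < (1/4:ℝ) * X / L := by positivity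
  have hpos : 0 < (piOdd x:ℝ) := lt_of_lt_of_le hp0 hp
  refine ⟨hpos, ?_⟩
  rw [div_le_iff₀ hpos]
  have hlogR : 0 < Real.log ((R:ℝ)+1) := Real.log_pos (by linarith)
  -- X / log(R+1) ≤ 80 pi
  have hq : (X:ℝ) / Real.log ((R:ℝ)+1) ≤ 80 * piOdd x := by
    have h1 : (X:ℝ) / Real.log ((R:ℝ)+1) ≤ 80 * ((1/4:ℝ) * X / L) := by
      rw [div_le_iff₀ hlogR]
      have : 80 * (1/4 * (X:ℝ) / L) * Real.log ((R:ℝ)+1) = X * (20 * Real.log ((R:ℝ)+1) / L) := by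
        field_simp; ring
      rw [this]
      have h3 : 1 ≤ 20 * Real.log ((R:ℝ)+1) / L := by rw [le_div_iff₀ (by linarith)]; linarith
      nlinarith
    linarith
  have hlogR0 := hlogR
  have haM : ∑ m ∈ range M, ((((oddPrimesUpTo x).filter (fun p => m < fpt ε p)).card : ℝ))
      = (∑ m ∈ range M, aCoef ε m x) * piOdd x := by
    rw [Finset.sum_mul]
    refine Finset.sum_congr rfl fun m _ => ?_
    unfold aCoef
    field_simp
  have hsub : ∀ m : ℕ, 1 ≤ m → (oddPrimesUpTo x).filter (fun p => m < fpt ε p) ⊆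
      (range (X+1)).filter (fun p => (p.Prime ∧ p≠2) ∧ ε*m ≤ (S m p:ℝ)) := by
    intro m hm p hp
    simp only [oddPrimesUpTo, Finset.mem_filter, ← hXd] at hp
    rw [Finset.mem_filter]
    exact ⟨hp.1.1, hp.1.2, S_ge_of_lt ε p m hm hp.2⟩
  have h1 := sum_fpt_upper (oddPrimesUpTo x) (fpt ε) R
  -- split
  have h2 : ∑ m ∈ range R, ((((oddPrimesUpTo x).filter (fun p => m < fpt ε p)).card : ℝ))
      ≤ ∑ m ∈ range M, ((((oddPrimesUpTo x).filter (fun p => m < fpt ε p)).card : ℝ))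
       + ∑ m ∈ Ico M R, ((((oddPrimesUpTo x).filter (fun p => m < fpt ε p)).card : ℝ)) := by
    rw [← Finset.sum_union]
    · refine Finset.sum_le_sum_of_subset_of_nonneg ?_ (fun _ _ _ => by positivity)
      intro m hm
      simp only [Finset.mem_range, Finset.mem_union, Finset.mem_Ico] at hm ⊢
      omega
    · rw [Finset.disjoint_left]
      intro m hm hm'
      simp only [Finset.mem_range, Finset.mem_Ico] at hm hm'
      omega
  have h3 : ∑ m ∈ Ico M R, ((((oddPrimesUpTo x).filter (fun p => m < fpt ε p)).card : ℝ))
      ≤ K1 * (Btail M * (X / Real.log ((R:ℝ)+1)) + (R:ℝ)^9) := by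
    calc _ ≤ ∑ m ∈ Ico M R, K1 * ((m:ℝ)^(-(3/2):ℝ) * (X / Real.log ((R:ℝ)+1)) + (R:ℝ)^8) := by
          refine Finset.sum_le_sum fun m hm => ?_
          rw [Finset.mem_Ico] at hm
          refine le_trans ?_ (hmed m R X (by omega) (by omega))
          exact_mod_cast Finset.card_le_card (hsub m (by omega))
      _ = K1 * ((∑ m ∈ Ico M R, (m:ℝ)^(-(3/2):ℝ)) * (X / Real.log ((R:ℝ)+1)) + ((R-M:ℕ):ℝ) * (R:ℝ)^8) := by
          rw [← Finset.mul_sum, Finset.sum_add_distrib, Finset.sum_mul, Finset.sum_const, nsmul_eq_mul, Nat.card_Ico]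
      _ ≤ _ := by
          refine mul_le_mul_of_nonneg_left ?_ hK1.le
          refine add_le_add (mul_le_mul_of_nonneg_right (sum_le_Btail M R) (by positivity)) ?_
          have : ((R-M:ℕ):ℝ) ≤ R := by exact_mod_cast Nat.sub_le R M
          calc ((R-M:ℕ):ℝ) * (R:ℝ)^8 ≤ R * (R:ℝ)^8 := by gcongr
            _ = _ := by ring
  have hsq : √(X:ℝ) = y^10 := by
    rw [← hyX, show y^20 = (y^10)^2 by ring, Real.sqrt_sq (by positivity)]
  have h4 : ∑ p ∈ (oddPrimesUpTo x).filter (fun p => R < fpt ε p), (fpt ε p : ℝ)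
      ≤ K2 * (R:ℝ)^2 * (2 + 4 * L * y^10 / ε) := by
    calc _ ≤ ∑ p ∈ (oddPrimesUpTo x).filter (fun p => R < fpt ε p), (2 + 4 * L * y^10 / ε) := by
          refine Finset.sum_le_sum fun p hp => ?_
          simp only [oddPrimesUpTo, Finset.mem_filter, Finset.mem_range, ← hXd] at hp
          have hpX : p ≤ X := by omega
          refine (fpt_le ε hε p hp.1.2.1 hp.1.2.2).trans ?_
          have a1 : (Nat.log 2 p:ℝ) ≤ 2 * L := by
            refine le_trans ?_ (natlog_le X (by have := hp.1.2.1.pos; omega))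
            exact_mod_cast Nat.log_mono_right hpX
          have a2 : √(p:ℝ) ≤ y^10 := by
            rw [← hsq]; exact Real.sqrt_le_sqrt (by exact_mod_cast hpX)
          have a3 : (Nat.log 2 p:ℝ) * √(p:ℝ) ≤ 2 * L * y^10 := mul_le_mul a1 a2 (by positivity) (by positivity)
          have : 2 * (Nat.log 2 p:ℝ) * √(p:ℝ) / ε ≤ 4 * L * y^10 / ε := by
            apply div_le_div_of_nonneg_right _ hε.le
            linarith
          linarith
      _ = (((oddPrimesUpTo x).filter (fun p => R < fpt ε p)).card:ℝ) * (2 + 4 * L * y^10 / ε) := by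
          rw [Finset.sum_const, nsmul_eq_mul]
      _ ≤ _ := by
          refine mul_le_mul_of_nonneg_right ?_ (by positivity)
          refine le_trans ?_ (hlarge R X hRR0 hR1 hXR)
          exact_mod_cast Finset.card_le_card (hsub R hR1)
  -- error bound
  set Z := L * y^12 with hZ
  have hy1 : 1 ≤ y := by linarith
  have e9 : (R:ℝ)^9 ≤ Z := by
    calc (R:ℝ)^9 ≤ y^9 := pow_le_pow_left₀ (by positivity) hRy 9
      _ ≤ y^12 := pow_le_pow_right₀ hy1 (by norm_num)
      _ ≤ Z := by rw [hZ]; exact le_mul_of_one_le_left (by positivity) hL1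
  have e2 : (R:ℝ)^2 * (2 + 4 * L * y^10 / ε) ≤ (2 + 4/ε) * Z := by
    calc (R:ℝ)^2 * (2 + 4 * L * y^10 / ε) ≤ y^2 * (2 + 4 * L * y^10 / ε) := by
          gcongr
      _ = 2 * y^2 + 4/ε * Z := by rw [hZ]; ring
      _ ≤ 2 * Z + 4/ε * Z := by
          have : y^2 ≤ Z := by
            calc y^2 ≤ y^12 := pow_le_pow_right₀ hy1 (by norm_num)
              _ ≤ Z := by rw [hZ]; exact le_mul_of_one_le_left (by positivity) hL1
          linarith
      _ = _ := by ring
  have hy5 : (X:ℝ)^(1/5:ℝ) = y^4 := by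
    rw [hy, ← Real.rpow_natCast, ← Real.rpow_mul (by positivity)]; norm_num
  rw [hy5]
  have hZp : Z ≤ 4 * (L / y^4)^2 * piOdd x := by
    have : Z = 4 * (L / y^4)^2 * (1/4 * X / L) := by
      rw [hZ, ← hyX]; field_simp
    rw [this]
    exact mul_le_mul_of_nonneg_left hp (by positivity)
  have hB0 : 0 ≤ Btail M := tsum_nonneg fun i => by positivity
  have f1 : K1 * (Btail M * (X / Real.log ((R:ℝ)+1))) ≤ K1 * (Btail M * (80 * piOdd x)) := by gcongr
  have f2 : K1 * (R:ℝ)^9 ≤ K1 * Z := by gcongr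
  have f3 : K2 * ((R:ℝ)^2 * (2 + 4 * L * y^10 / ε)) ≤ K2 * ((2 + 4/ε) * Z) := by gcongr
  set G := (L / y^4)^2 with hG
  have hG0 : 0 ≤ G := by positivity
  set A := K1 + K2*(2+4/ε) with hA
  have hA0 : 0 < A := by positivity
  have f4 : A * Z ≤ A * (4 * G * piOdd x) := by gcongr
  have f5 : 0 ≤ 4*A*(Btail M * piOdd x) := by positivity
  have f6 : 0 ≤ 80*K1*(G * piOdd x) := by positivity
  have hAZ : A * Z = K1 * Z + K2 * ((2 + 4/ε) * Z) := by rw [hA]; ring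
  have goal_eq : (∑ m ∈ range M, aCoef ε m x + (80*K1 + 4*A) * Btail M + (80*K1 + 4*A) * G) * (piOdd x:ℝ)
     = (∑ m ∈ range M, aCoef ε m x) * piOdd x + K1 * (Btail M * (80 * piOdd x)) + 4*A*(Btail M * piOdd x)
       + 80*K1*(G * piOdd x) + A * (4 * G * piOdd x) := by ring
  rw [goal_eq, ← haM]
  have h4' : K2 * (R:ℝ)^2 * (2 + 4 * L * y^10 / ε) = K2 * ((R:ℝ)^2 * (2 + 4 * L * y^10 / ε)) := by ring
  have h3' : K1 * (Btail M * (X / Real.log ((R:ℝ)+1)) + (R:ℝ)^9) = K1 * (Btail M * (X / Real.log ((R:ℝ)+1))) + K1 * (R:ℝ)^9 := by ring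
  rw [h4'] at h4
  rw [h3'] at h3
  linarith

theorem eta_tendsto : Tendsto (fun x : ℝ => (Real.log (⌊x⌋₊:ℝ) / (⌊x⌋₊:ℝ)^(1/5:ℝ))^2) atTop (nhds 0) := by
  have h1 : Tendsto (fun t : ℝ => Real.log t / t^(1/5:ℝ)) atTop (nhds 0) :=
    (isLittleO_log_rpow_atTop (by norm_num)).tendsto_div_nhds_zero
  have h2 : Tendsto (fun x : ℝ => (⌊x⌋₊:ℝ)) atTop atTop :=
    tendsto_natCast_atTop_atTop.comp tendsto_nat_floor_atTop
  simpa using (h1.comp h2).pow 2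

theorem final_aux (F η : ℝ → ℝ) (a : ℕ → ℝ → ℝ) (ahat : ℕ → ℝ) (K : ℝ) (B : ℕ → ℝ)
    (ha : ∀ m, Tendsto (a m) atTop (nhds (ahat m))) (hsum : Summable ahat)
    (hB : Tendsto B atTop (nhds 0)) (hη : Tendsto η atTop (nhds 0))
    (hup : ∀ M, 1 ≤ M → ∀ᶠ x in atTop, F x ≤ ∑ m ∈ range M, a m x + K * B M + K * η x)
    (hlo : ∀ M, 1 ≤ M → ∀ᶠ x in atTop, ∑ m ∈ range M, a m x ≤ F x) :
    Tendsto F atTop (nhds (∑' m, ahat m)) := by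
  rw [Metric.tendsto_atTop']
  have hT := hsum.hasSum.tendsto_sum_nat
  have hKB : Tendsto (fun M => K * B M) atTop (nhds 0) := by simpa using hB.const_mul K
  have hKη : Tendsto (fun x => K * η x) atTop (nhds 0) := by simpa using hη.const_mul K
  intro δ hδ
  have hδ4 : 0 < δ/4 := by linarith
  obtain ⟨M, h1, h2, hM⟩ := ((hT.eventually (Metric.ball_mem_nhds _ hδ4)).and
    ((hKB.eventually (Metric.ball_mem_nhds _ hδ4)).and (eventually_ge_atTop 1))).exists
  have hs : Tendsto (fun x => ∑ m ∈ range M, a m x) atTop (nhds (∑ m ∈ range M, ahat m)) :=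
    tendsto_finset_sum _ fun m _ => ha m
  have hev := (hs.eventually (Metric.ball_mem_nhds _ hδ4)).and
    ((hKη.eventually (Metric.ball_mem_nhds _ hδ4)).and ((hup M hM).and (hlo M hM)))
  obtain ⟨N, hN⟩ := eventually_atTop.mp hev
  refine ⟨N, fun x hx => ?_⟩
  obtain ⟨g1, g2, g3, g4⟩ := hN x hx.le
  simp only [Metric.mem_ball, Real.dist_eq, abs_lt] at *
  constructor <;> linarith [h1.1, h1.2, h2.1, h2.2, g1.1, g1.2, g2.1, g2.2]

theorem stmt17_aux (ε : ℝ) (hε : 0 < ε) (ahat : ℕ → ℝ)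
    (ha : ∀ m, Tendsto (fun x : ℝ => aCoef ε m x) atTop (nhds (ahat m))) (hsum : Summable ahat) :
    Tendsto (fun x : ℝ => (∑ p ∈ oddPrimesUpTo x, (fpt ε p : ℝ)) / (piOdd x : ℝ)) atTop
      (nhds (∑' m, ahat m)) := by
  obtain ⟨K, hK, X0, h⟩ := core_upper ε hε
  have hev : ∀ᶠ x : ℝ in atTop, X0 ≤ ⌊x⌋₊ := tendsto_nat_floor_atTop.eventually_ge_atTop X0
  refine final_aux _ _ (fun m x => aCoef ε m x) ahat K Btail ha hsum Btail_tendsto eta_tendsto ?_ ?_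
  · intro M hM
    filter_upwards [hev] with x hx
    exact (h x hx M hM).2
  · intro M hM
    filter_upwards [hev] with x hx
    have hpos := (h x hx M hM).1
    rw [le_div_iff₀ hpos, Finset.sum_mul]
    refine le_trans (le_of_eq ?_) (sum_fpt_lower (oddPrimesUpTo x) (fpt ε) M)
    refine Finset.sum_congr rfl fun m _ => ?_
    unfold aCoef
    field_simp

/-- For fixed `ε ∈ (0,1]`: with `â_m = lim_{x→∞} a_m(x)` (these limits exist and
`∑_{m ≥ 0} â_m` converges), one has
`lim_{x→∞} (1/π_odd(x)) ∑_{p ≤ x} f_ε(p) = ∑_{m ≥ 0} â_m`. -/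
theorem stmt17 (ε : ℝ) (hε : 0 < ε) (hε1 : ε ≤ 1) (ahat : ℕ → ℝ)
    (ha : ∀ m : ℕ, Filter.Tendsto (fun x : ℝ => aCoef ε m x) Filter.atTop (nhds (ahat m)))
    (hsum : Summable ahat) :
    Filter.Tendsto
      (fun x : ℝ => (∑ p ∈ oddPrimesUpTo x, (fpt ε p : ℝ)) / (piOdd x : ℝ))
      Filter.atTop (nhds (∑' m : ℕ, ahat m)) := stmt17_aux ε hε ahat ha hsum

end
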